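/- arXiv:2510.26652 — 4 statements merged into one kernel-verified Lean document; each statement's English description precedes it below -/
import Mathlib

section
/- Let K be a totally real number field, let n ≥ 1 be an integer, and let m be a positive integer with m ≤ n + 1. For every finite family L_1, …, L_s of O_K-lattices of rank m, there exists an O_K-lattice of rank n that is not represented by any of the L_i. -/
open scoped TensorProduct

noncomputable section

open NumberField

structure OKLattice (K : Type) [Field K] : Type 1 where
  carrier : Type
  [addCommGroup : AddCommGroup carrier]
  [module : Module (𝓞 K) carrier]
  [finite : Module.Finite (𝓞 K) carrier]
  [torsionFree : NoZeroSMulDivisors (𝓞 K) carrier]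
  form : carrier →ₗ[𝓞 K] carrier →ₗ[𝓞 K] 𝓞 K
  symm : ∀ x y, form x y = form y x
  posDef : ∀ v : carrier, v ≠ 0 → ∀ σ : K →+* ℝ, 0 < σ (algebraMap (𝓞 K) K (form v v))

attribute [instance] OKLattice.addCommGroup OKLattice.module OKLattice.finite
  OKLattice.torsionFree

namespace OKLattice

variable {K : Type} [Field K]

/-- The rank of an `O_K`-lattice: the `K`-dimension of `L ⊗ K`. -/
def rank (L : OKLattice K) : ℕ :=
  Module.finrank K (K ⊗[𝓞 K] L.carrier)

/-- `L.Represents L'` : `L'` is represented by `L`. -/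
def Represents (L L' : OKLattice K) : Prop :=
  ∃ σ : L'.carrier →ₗ[𝓞 K] L.carrier, ∀ x, L.form (σ x) (σ x) = L'.form x x

/-- `L` is `n`-universal. -/
def IsUniversal (L : OKLattice K) (n : ℕ) : Prop :=
  ∀ L' : OKLattice K, L'.rank = n → L.Represents L'

end OKLattice

/-- `U_K(n)`: the minimal rank of an `n`-universal `O_K`-lattice. -/
def minUnivRank (K : Type) [Field K] (n : ℕ) : ℕ :=
  sInf {m | ∃ L : OKLattice K, L.IsUniversal n ∧ L.rank = m}

/-- `K` is totally real: every embedding into `ℂ` has image contained in `ℝ`. -/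
def TotallyReal (K : Type) [Field K] : Prop :=
  ∀ φ : K →+* ℂ, ∀ x : K, (φ x).im = 0

open Filter Topology

/-- The weight `n ^ (-s)` of a norm `n`, as an extended nonnegative real. -/
def normWeight (s : ℝ) (n : ℕ) : ENNReal := ENNReal.ofReal ((n : ℝ) ^ (-s))

lemma normWeight_mul (s : ℝ) (a b : ℕ) :
    normWeight s (a * b) = normWeight s a * normWeight s b := by
  unfold normWeight
  rw [Nat.cast_mul, Real.mul_rpow (by positivity) (by positivity),
    ENNReal.ofReal_mul (by positivity)]

lemma normWeight_zero {s : ℝ} (hs : 1 < s) : normWeight s 0 = 0 := by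
  simp [normWeight, Real.zero_rpow (by linarith : -s ≠ 0)]

lemma normWeight_le_half {s : ℝ} (hs : 1 < s) {n : ℕ} (hn : 2 ≤ n) :
    normWeight s n ≤ 2⁻¹ := by
  unfold normWeight
  have h2 : (2⁻¹ : ENNReal) = ENNReal.ofReal (2⁻¹ : ℝ) := by
    rw [ENNReal.ofReal_inv_of_pos (by norm_num)]; simp
  rw [h2]
  apply ENNReal.ofReal_le_ofReal
  have hn' : (2 : ℝ) ≤ n := by exact_mod_cast hn
  calc (n : ℝ) ^ (-s) ≤ (n : ℝ) ^ (-1 : ℝ) :=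
        Real.rpow_le_rpow_of_exponent_le (by linarith) (by linarith)
    _ = (n : ℝ)⁻¹ := Real.rpow_neg_one _
    _ ≤ 2⁻¹ := by gcongr

/-- The Dedekind zeta series, as a sum over ideals in the extended nonnegative reals. -/
def idealZeta (K : Type*) [Field K] [NumberField K] (s : ℝ) : ENNReal :=
  ∑' I : Ideal (𝓞 K), normWeight s (Ideal.absNorm I)

lemma idealZeta_eq_tsum_card (K : Type*) [Field K] [NumberField K] (s : ℝ) :
    idealZeta K s = ∑' n : ℕ, ENNReal.ofReal
      ((Nat.card {I : Ideal (𝓞 K) // Ideal.absNorm I = n} : ℝ) * (n : ℝ) ^ (-s)) := by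
  unfold idealZeta
  rw [← (Equiv.sigmaFiberEquiv (fun I : Ideal (𝓞 K) => Ideal.absNorm I)).tsum_eq,
    ENNReal.tsum_sigma']
  refine tsum_congr fun n => ?_
  have h : ∀ I : {I : Ideal (𝓞 K) // Ideal.absNorm I = n},
      normWeight s (Ideal.absNorm ((Equiv.sigmaFiberEquiv
        (fun I : Ideal (𝓞 K) => Ideal.absNorm I)) ⟨n, I⟩)) = normWeight s n := by
    rintro ⟨I, rfl⟩; rfl
  simp_rw [h]
  have : Finite {I : Ideal (𝓞 K) // Ideal.absNorm I = n} :=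
    Ideal.finite_setOfPred_absNorm_eq n
  rw [ENNReal.tsum_const, ENNReal.ofReal_mul (by positivity), ENNReal.ofReal_natCast,
    ENat.card_eq_coe_natCard]
  rfl

lemma eventually_dedekindZeta_eq (K : Type*) [Field K] [NumberField K] :
    ∀ᶠ s : ℝ in 𝓝[>] 1, idealZeta K s ≠ ⊤ ∧
      dedekindZeta K s = ((idealZeta K s).toReal : ℂ) := by
  have h1 := (tendsto_sub_one_mul_dedekindZeta_nhdsGT K).eventually_ne
    (Complex.ofReal_ne_zero.mpr (dedekindZeta_residue_ne_zero K))
  filter_upwards [h1, self_mem_nhdsWithin] with s hs hs1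
  have hs1 : 1 < s := hs1
  have hz : dedekindZeta K s ≠ 0 := right_ne_zero_of_mul hs
  set f : ℕ → ℝ := fun n =>
    (Nat.card {I : Ideal (𝓞 K) // Ideal.absNorm I = n} : ℝ) * (n : ℝ) ^ (-s) with hf
  have hterm : ∀ n, LSeries.term
      (fun n ↦ (Nat.card {I : Ideal (𝓞 K) // Ideal.absNorm I = n} : ℂ)) s n = (f n : ℂ) := by
    intro n
    rcases eq_or_ne n 0 with rfl | hn
    · simp [hf, Real.zero_rpow (by linarith : -s ≠ 0)]
    · rw [LSeries.term_of_ne_zero hn, hf]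
      push_cast
      rw [Complex.ofReal_cpow (by positivity), div_eq_mul_inv, ← Complex.cpow_neg]
      simp
  have hZ : dedekindZeta K s = ∑' n, (f n : ℂ) := by
    unfold dedekindZeta LSeries
    exact tsum_congr hterm
  have hsum : Summable f := by
    by_contra hns
    apply hz
    rw [hZ]
    apply tsum_eq_zero_of_not_summable
    rwa [Complex.summable_ofReal]
  have hE : idealZeta K s = ENNReal.ofReal (∑' n, f n) := by
    rw [idealZeta_eq_tsum_card K s, ENNReal.ofReal_tsum_of_nonneg _ hsum]
    intro n; positivity
  refine ⟨by rw [hE]; exact ENNReal.ofReal_ne_top, ?_⟩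
  rw [hZ, hE, ENNReal.toReal_ofReal (tsum_nonneg fun n => by positivity), Complex.ofReal_tsum]

lemma tendsto_sub_one_mul_idealZeta (K : Type*) [Field K] [NumberField K] :
    Tendsto (fun s : ℝ => (s - 1) * (idealZeta K s).toReal) (𝓝[>] 1)
      (𝓝 (dedekindZeta_residue K)) := by
  have h := (Complex.continuous_re.tendsto _).comp (tendsto_sub_one_mul_dedekindZeta_nhdsGT K)
  refine (h.congr' ?_)
  filter_upwards [eventually_dedekindZeta_eq K] with s hs
  simp only [Function.comp, hs.2]
  rw [← Complex.ofReal_one, ← Complex.ofReal_sub, ← Complex.ofReal_mul, Complex.ofReal_re]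

/-- The sum of `idealZeta` restricted to the nonzero ideals divisible by no prime of `S`. -/
def idealZetaAway {K : Type*} [Field K] [NumberField K] (S : Finset (Ideal (𝓞 K))) (s : ℝ) :
    ENNReal :=
  ∑' I : {I : Ideal (𝓞 K) // I ≠ ⊥ ∧ ∀ p ∈ S, ¬ p ∣ I}, normWeight s (Ideal.absNorm I.1)

lemma two_le_absNorm {K : Type*} [Field K] [NumberField K] {p : Ideal (𝓞 K)} (hp : p.IsPrime)
    (hp0 : p ≠ ⊥) : 2 ≤ Ideal.absNorm p := by
  have h0 : Ideal.absNorm p ≠ 0 := by rwa [Ne, Ideal.absNorm_eq_zero_iff]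
  have h1 : Ideal.absNorm p ≠ 1 := by rw [Ne, Ideal.absNorm_eq_one_iff]; exact hp.ne_top
  omega

lemma idealZetaAway_le_two_mul {K : Type*} [Field K] [NumberField K] {s : ℝ} (hs : 1 < s)
    (hfin : idealZeta K s ≠ ⊤) (S : Finset (Ideal (𝓞 K))) (p : Ideal (𝓞 K)) (hp : p.IsPrime)
    (hp0 : p ≠ ⊥) : idealZetaAway S s ≤ 2 * idealZetaAway (insert p S) s := by
  set Z := idealZetaAway S s
  set Z' := idealZetaAway (insert p S) s
  have hZ : Z ≠ ⊤ := ne_top_of_le_ne_top hfin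
    (ENNReal.tsum_comp_le_tsum_of_injective Subtype.val_injective
      (fun I : Ideal (𝓞 K) => normWeight s (Ideal.absNorm I)))
  let A := {I : Ideal (𝓞 K) // I ≠ ⊥ ∧ ∀ q ∈ S, ¬ q ∣ I}
  let A' := {I : Ideal (𝓞 K) // I ≠ ⊥ ∧ ∀ q ∈ insert p S, ¬ q ∣ I}
  have key : ∀ I : A, ∃ y : A' ⊕ A, Sum.elim (fun J : A' => J.1) (fun J : A => p * J.1) y = I.1 := by
    intro I
    by_cases h : p ∣ I.1
    · obtain ⟨J, hJ⟩ := h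
      refine ⟨Sum.inr ⟨J, fun h0 => I.2.1 (by rw [hJ, h0, Ideal.mul_bot]),
        fun q hq hqJ => I.2.2 q hq (hJ ▸ hqJ.mul_left p)⟩, hJ.symm⟩
    · refine ⟨Sum.inl ⟨I.1, I.2.1, fun q hq => ?_⟩, rfl⟩
      rcases Finset.mem_insert.mp hq with rfl | hq
      · exact h
      · exact I.2.2 q hq
  choose g hg using key
  have hginj : Function.Injective g := fun I J h => Subtype.ext (by rw [← hg, ← hg, h])
  have h1 : Z ≤ Z' + normWeight s (Ideal.absNorm p) * Z := by
    calc Z = ∑' I : A, normWeight s (Ideal.absNorm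
          (Sum.elim (fun J : A' => J.1) (fun J : A => p * J.1) (g I))) := by
          refine tsum_congr fun I => ?_
          rw [hg]
      _ ≤ ∑' y : A' ⊕ A, normWeight s (Ideal.absNorm
          (Sum.elim (fun J : A' => J.1) (fun J : A => p * J.1) y)) :=
        ENNReal.tsum_comp_le_tsum_of_injective hginj (fun y => normWeight s (Ideal.absNorm
          (Sum.elim (fun J : A' => J.1) (fun J : A => p * J.1) y)))
      _ = Z' + normWeight s (Ideal.absNorm p) * Z := by
        rw [ENNReal.summable.tsum_sum ENNReal.summable]
        simp only [Sum.elim_inl, Sum.elim_inr, map_mul, normWeight_mul, ENNReal.tsum_mul_left]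
        rfl
  have h2 : Z ≤ Z' + 2⁻¹ * Z := h1.trans (by
    gcongr; exact normWeight_le_half hs (two_le_absNorm hp hp0))
  have h3 : 2⁻¹ * Z ≤ Z' := by
    have : Z = 2⁻¹ * Z + 2⁻¹ * Z := by rw [← add_mul, ENNReal.inv_two_add_inv_two, one_mul]
    have hh : 2⁻¹ * Z + 2⁻¹ * Z ≤ Z' + 2⁻¹ * Z := this ▸ h2
    exact (ENNReal.add_le_add_iff_right (ENNReal.mul_ne_top (by simp) hZ)).mp hh
  calc Z = 2 * (2⁻¹ * Z) := by
        rw [← mul_assoc, ENNReal.mul_inv_cancel (by simp) (by simp), one_mul]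
    _ ≤ 2 * Z' := by gcongr

lemma idealZeta_le_two_pow_mul {K : Type*} [Field K] [NumberField K] {s : ℝ} (hs : 1 < s)
    (hfin : idealZeta K s ≠ ⊤) (S : Finset (Ideal (𝓞 K)))
    (hS : ∀ p ∈ S, p.IsPrime ∧ p ≠ ⊥) :
    idealZeta K s ≤ 2 ^ S.card * idealZetaAway S s := by
  induction S using Finset.induction_on with
  | empty =>
    have : idealZetaAway (K := K) ∅ s = idealZeta K s := by
      unfold idealZetaAway idealZeta
      have hsupp : Function.support (fun I : Ideal (𝓞 K) => normWeight s (Ideal.absNorm I)) ⊆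
          {I | I ≠ ⊥ ∧ ∀ p ∈ (∅ : Finset (Ideal (𝓞 K))), ¬ p ∣ I} := by
        intro I hI
        refine ⟨fun h => hI ?_, by simp⟩
        simp [h, normWeight_zero hs]
      exact tsum_subtype_eq_of_support_subset hsupp
    simp [this]
  | insert p S hpS ih =>
    rw [Finset.card_insert_of_notMem hpS, pow_succ, mul_assoc]
    refine (ih fun q hq => hS q (Finset.mem_insert_of_mem hq)).trans ?_
    gcongr
    obtain ⟨h1, h2⟩ := hS p (Finset.mem_insert_self _ _)
    exact idealZetaAway_le_two_mul hs hfin S p h1 h2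

lemma absNorm_eq_of_two_primes {K L : Type*} [Field K] [NumberField K] [Field L] [NumberField L]
    [Algebra K L] (h2 : Module.finrank K L = 2) {p : Ideal (𝓞 K)} (hp : p.IsPrime) (hp0 : p ≠ ⊥)
    {P P' : Ideal (𝓞 L)} (hP : P.IsPrime) (hP' : P'.IsPrime) (hne : P ≠ P')
    (hPp : P.LiesOver p) (hPp' : P'.LiesOver p) :
    Ideal.absNorm P = Ideal.absNorm p ∧ Ideal.absNorm P' = Ideal.absNorm p := by
  have hpm : p.IsMaximal := hp.isMaximal hp0
  have hle : ∀ Q : Ideal (𝓞 L), Q.IsPrime → Q.LiesOver p →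
      Ideal.absNorm p ≤ Ideal.absNorm Q := by
    intro Q hQ hQp
    rw [Ideal.absNorm_eq_pow_inertiaDeg'_of_liesOver Q p hp hp0]
    exact Nat.le_self_pow (Ideal.inertiaDeg'_ne_zero p Q) _
  have hP0 : P ≠ ⊥ := Ideal.ne_bot_of_liesOver_of_ne_bot hp0 P
  have hP0' : P' ≠ ⊥ := Ideal.ne_bot_of_liesOver_of_ne_bot hp0 P'
  have hPm : P.IsMaximal := hP.isMaximal hP0
  have hPm' : P'.IsMaximal := hP'.isMaximal hP0'
  have hcop : IsCoprime P P' := Ideal.isCoprime_of_isMaximal hne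
  have hmap : ∀ Q : Ideal (𝓞 L), Q.LiesOver p → p.map (algebraMap (𝓞 K) (𝓞 L)) ≤ Q := by
    intro Q hQ
    rw [Ideal.map_le_iff_le_comap]
    exact hQ.over.le
  have hdvd : P * P' ∣ p.map (algebraMap (𝓞 K) (𝓞 L)) :=
    hcop.mul_dvd (Ideal.dvd_iff_le.mpr (hmap P hPp)) (Ideal.dvd_iff_le.mpr (hmap P' hPp'))
  have hn : Ideal.absNorm P * Ideal.absNorm P' ∣ Ideal.absNorm p ^ 2 := by
    have hfr : Module.finrank (𝓞 K) (𝓞 L) = 2 := by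
      rw [← h2]
      exact (IsFractionRing.finrank_eq (𝓞 K) K (𝓞 L) L).symm
    rw [← map_mul, ← hfr, ← Ideal.absNorm_algebraMap (R := 𝓞 K) (S := 𝓞 L)]
    exact Ideal.absNorm_dvd_absNorm_of_le (Ideal.dvd_iff_le.mp hdvd)
  have hpos : 0 < Ideal.absNorm p := by
    have := two_le_absNorm hp hp0
    omega
  have hle2 := Nat.le_of_dvd (by positivity) hn
  have a1 := hle P hP hPp
  have a2 := hle P' hP' hPp'
  constructor <;> nlinarith

lemma idealZetaAway_sq_le {K L : Type*} [Field K] [NumberField K] [Field L] [NumberField L]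
    [Algebra K L] (h2 : Module.finrank K L = 2) (S : Finset (Ideal (𝓞 K))) (s : ℝ)
    (hsplit : ∀ p : Ideal (𝓞 K), p.IsPrime → p ≠ ⊥ → p ∉ S → ∃ P P' : Ideal (𝓞 L),
      P.IsPrime ∧ P'.IsPrime ∧ P ≠ P' ∧ P.LiesOver p ∧ P'.LiesOver p) :
    idealZetaAway S s ^ 2 ≤ idealZeta L s := by
  classical
  have hsplit' : ∀ p : Ideal (𝓞 K), ∃ P P' : Ideal (𝓞 L), p.IsPrime → p ≠ ⊥ → p ∉ S →
      P.IsPrime ∧ P'.IsPrime ∧ P ≠ P' ∧ P.LiesOver p ∧ P'.LiesOver p := by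
    intro p
    by_cases h : p.IsPrime ∧ p ≠ ⊥ ∧ p ∉ S
    · obtain ⟨P, P', hh⟩ := hsplit p h.1 h.2.1 h.2.2
      exact ⟨P, P', fun _ _ _ => hh⟩
    · exact ⟨⊥, ⊥, fun h1 h2 h3 => absurd ⟨h1, h2, h3⟩ h⟩
  choose P P' hPP using hsplit'
  let A := {I : Ideal (𝓞 K) // I ≠ ⊥ ∧ ∀ p ∈ S, ¬ p ∣ I}
  let F : Ideal (𝓞 K) → Multiset (Ideal (𝓞 K)) := UniqueFactorizationMonoid.normalizedFactors
  have hF : ∀ (I : A), ∀ p ∈ F I.1, p.IsPrime ∧ p ≠ ⊥ ∧ p ∉ S := by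
    intro I p hp
    have hpr := UniqueFactorizationMonoid.prime_of_normalized_factor p hp
    exact ⟨Ideal.isPrime_of_prime hpr, hpr.ne_zero, fun hS =>
      I.2.2 p hS (UniqueFactorizationMonoid.dvd_of_mem_normalizedFactors hp)⟩
  have hFprod : ∀ I : A, (F I.1).prod = I.1 := fun I =>
    Ideal.prod_normalizedFactors_eq_self I.2.1
  let φ : A × A → Ideal (𝓞 L) := fun x => ((F x.1.1).map P + (F x.2.1).map P').prod
  let c : Ideal (𝓞 L) → Ideal (𝓞 K) := fun Q => Q.comap (algebraMap (𝓞 K) (𝓞 L))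
  have hnorm : ∀ x, Ideal.absNorm (φ x) = Ideal.absNorm x.1.1 * Ideal.absNorm x.2.1 := by
    intro x
    have h1 : ((F x.1.1).map P).map Ideal.absNorm = (F x.1.1).map Ideal.absNorm := by
      rw [Multiset.map_map]
      refine Multiset.map_congr rfl fun p hp => ?_
      obtain ⟨a1, a2, a3⟩ := hF _ p hp
      obtain ⟨b1, b2, b3, b4, b5⟩ := hPP p a1 a2 a3
      exact (absNorm_eq_of_two_primes h2 a1 a2 b1 b2 b3 b4 b5).1
    have h2 : ((F x.2.1).map P').map Ideal.absNorm = (F x.2.1).map Ideal.absNorm := by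
      rw [Multiset.map_map]
      refine Multiset.map_congr rfl fun p hp => ?_
      obtain ⟨a1, a2, a3⟩ := hF _ p hp
      obtain ⟨b1, b2, b3, b4, b5⟩ := hPP p a1 a2 a3
      exact (absNorm_eq_of_two_primes h2 a1 a2 b1 b2 b3 b4 b5).2
    simp only [φ]
    rw [Multiset.prod_add, map_mul, map_multiset_prod, map_multiset_prod, h1, h2,
      ← map_multiset_prod, ← map_multiset_prod, hFprod, hFprod]
  have hfac : ∀ x, UniqueFactorizationMonoid.normalizedFactors (φ x) =
      (F x.1.1).map P + (F x.2.1).map P' := by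
    intro x
    apply UniqueFactorizationMonoid.normalizedFactors_prod_of_prime
    intro Q hQ
    rcases Multiset.mem_add.mp hQ with hQ | hQ
    · obtain ⟨p, hp, rfl⟩ := Multiset.mem_map.mp hQ
      obtain ⟨a1, a2, a3⟩ := hF _ p hp
      obtain ⟨b1, b2, b3, b4, b5⟩ := hPP p a1 a2 a3
      exact Ideal.prime_of_isPrime (Ideal.ne_bot_of_liesOver_of_ne_bot a2 _) b1
    · obtain ⟨p, hp, rfl⟩ := Multiset.mem_map.mp hQ
      obtain ⟨a1, a2, a3⟩ := hF _ p hp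
      obtain ⟨b1, b2, b3, b4, b5⟩ := hPP p a1 a2 a3
      exact Ideal.prime_of_isPrime (Ideal.ne_bot_of_liesOver_of_ne_bot a2 _) b2
  have hc1 : ∀ (I : A), ∀ p ∈ F I.1, c (P p) = p ∧ c (P' p) = p ∧ P p ≠ P' p := by
    intro I p hp
    obtain ⟨a1, a2, a3⟩ := hF _ p hp
    obtain ⟨b1, b2, b3, b4, b5⟩ := hPP p a1 a2 a3
    exact ⟨b4.over.symm, b5.over.symm, b3⟩
  have hrec1 : ∀ x : A × A, ((UniqueFactorizationMonoid.normalizedFactors (φ x)).filter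
      (fun Q => Q = P (c Q))).map c = F x.1.1 := by
    intro x
    rw [hfac, Multiset.filter_add, Multiset.filter_eq_self.mpr, Multiset.filter_eq_nil.mpr,
      add_zero, Multiset.map_map]
    · conv_rhs => rw [← Multiset.map_id (F x.1.1)]
      exact Multiset.map_congr rfl fun p hp => (hc1 _ p hp).1
    · intro Q hQ
      obtain ⟨p, hp, rfl⟩ := Multiset.mem_map.mp hQ
      obtain ⟨b1, b2, b3⟩ := hc1 _ p hp
      rw [b2]
      exact b3.symm
    · intro Q hQ
      obtain ⟨p, hp, rfl⟩ := Multiset.mem_map.mp hQ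
      rw [(hc1 _ p hp).1]
  have hrec2 : ∀ x : A × A, ((UniqueFactorizationMonoid.normalizedFactors (φ x)).filter
      (fun Q => Q = P' (c Q))).map c = F x.2.1 := by
    intro x
    rw [hfac, Multiset.filter_add, Multiset.filter_eq_nil.mpr, Multiset.filter_eq_self.mpr,
      zero_add, Multiset.map_map]
    · conv_rhs => rw [← Multiset.map_id (F x.2.1)]
      exact Multiset.map_congr rfl fun p hp => (hc1 _ p hp).2.1
    · intro Q hQ
      obtain ⟨p, hp, rfl⟩ := Multiset.mem_map.mp hQ
      rw [(hc1 _ p hp).2.1]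
    · intro Q hQ
      obtain ⟨p, hp, rfl⟩ := Multiset.mem_map.mp hQ
      obtain ⟨b1, b2, b3⟩ := hc1 _ p hp
      rw [b1]
      exact b3
  have hinj : Function.Injective φ := by
    intro x y hxy
    refine Prod.ext (Subtype.ext ?_) (Subtype.ext ?_)
    · rw [← hFprod x.1, ← hFprod y.1, ← hrec1 x, ← hrec1 y, hxy]
    · rw [← hFprod x.2, ← hFprod y.2, ← hrec2 x, ← hrec2 y, hxy]
  calc idealZetaAway S s ^ 2
      = ∑' x : A × A, normWeight s (Ideal.absNorm (φ x)) := by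
        simp_rw [hnorm, normWeight_mul]
        rw [ENNReal.tsum_prod (f := fun a b : A =>
          normWeight s (Ideal.absNorm a.1) * normWeight s (Ideal.absNorm b.1))]
        simp_rw [ENNReal.tsum_mul_left, ENNReal.tsum_mul_right, sq]
        rfl
    _ ≤ idealZeta L s := ENNReal.tsum_comp_le_tsum_of_injective hinj
        (fun I : Ideal (𝓞 L) => normWeight s (Ideal.absNorm I))

lemma exists_prime_not_split {K L : Type*} [Field K] [NumberField K] [Field L] [NumberField L]
    [Algebra K L] (h2 : Module.finrank K L = 2) (S : Finset (Ideal (𝓞 K)))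
    (hS : ∀ p ∈ S, p.IsPrime ∧ p ≠ ⊥) :
    ∃ p : Ideal (𝓞 K), p.IsPrime ∧ p ≠ ⊥ ∧ p ∉ S ∧ ∀ P P' : Ideal (𝓞 L),
      P.IsPrime → P'.IsPrime → P.LiesOver p → P'.LiesOver p → P = P' := by
  by_contra! hcon
  have hsq : ∀ s, idealZetaAway S s ^ 2 ≤ idealZeta L s := by
    intro s
    refine idealZetaAway_sq_le h2 S s fun p h1 h2 h3 => ?_
    obtain ⟨P, P', a1, a2, a3, a4, a5⟩ := hcon p h1 h2 h3
    exact ⟨P, P', a1, a2, a5, a3, a4⟩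
  set C : ℝ := (2 ^ S.card) ^ 2
  have hineq : ∀ᶠ s : ℝ in 𝓝[>] 1, ((s - 1) * (idealZeta K s).toReal) ^ 2 ≤
      C * ((s - 1) * ((s - 1) * (idealZeta L s).toReal)) := by
    filter_upwards [eventually_dedekindZeta_eq K, eventually_dedekindZeta_eq L,
      self_mem_nhdsWithin] with s hK hL hs
    have hs : 1 < s := hs
    have h : idealZeta K s ^ 2 ≤ (2 ^ S.card) ^ 2 * idealZeta L s := by
      calc idealZeta K s ^ 2 ≤ (2 ^ S.card * idealZetaAway S s) ^ 2 := by
            gcongr; exact idealZeta_le_two_pow_mul hs hK.1 S hS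
        _ ≤ _ := by rw [mul_pow]; gcongr; exact hsq s
    have h' := ENNReal.toReal_mono (ENNReal.mul_ne_top (by simp) hL.1) h
    simp only [ENNReal.toReal_pow, ENNReal.toReal_mul, ENNReal.toReal_ofNat] at h'
    calc ((s - 1) * (idealZeta K s).toReal) ^ 2
        = (s - 1) ^ 2 * (idealZeta K s).toReal ^ 2 := by ring
      _ ≤ (s - 1) ^ 2 * ((2 ^ S.card) ^ 2 * (idealZeta L s).toReal) := by gcongr
      _ = _ := by simp only [C]; ring
  have hl := (tendsto_sub_one_mul_idealZeta K).pow 2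
  have h0 : Tendsto (fun s : ℝ => s - 1) (𝓝[>] 1) (𝓝 0) := by
    have : Tendsto (fun s : ℝ => s - 1) (𝓝 1) (𝓝 (1 - 1)) :=
      (continuous_id.sub continuous_const).tendsto _
    rw [sub_self] at this
    exact this.mono_left nhdsWithin_le_nhds
  have hr := (h0.mul (tendsto_sub_one_mul_idealZeta L)).const_mul C
  have := le_of_tendsto_of_tendsto hl hr hineq
  have hpos := dedekindZeta_residue_pos K
  rw [zero_mul, mul_zero] at this
  exact absurd this (not_le.mpr (by positivity))

lemma exists_prime_forall_sq_add_notMem {K : Type*} [Field K] [NumberField K] (T : 𝓞 K)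
    (hT : ¬ IsSquare (-(T : K))) :
    ∃ p : Ideal (𝓞 K), p.IsPrime ∧ p ≠ ⊥ ∧ T ∉ p ∧ ∀ x : 𝓞 K, x ^ 2 + T ∉ p := by
  classical
  have hT0 : T ≠ 0 := by
    rintro rfl
    exact hT (by simp)
  set f : Polynomial K := Polynomial.X ^ 2 + Polynomial.C (T : K) with hf
  have hmonic : f.Monic := Polynomial.monic_X_pow_add_C _ two_ne_zero
  have hdeg : f.natDegree = 2 := Polynomial.natDegree_X_pow_add_C
  have hirr : Irreducible f := by
    rw [Polynomial.Monic.irreducible_iff_roots_eq_zero_of_degree_le_three hmonic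
      (by omega) (by omega)]
    refine Multiset.eq_zero_of_forall_notMem fun x hx => hT ⟨x, ?_⟩
    have := (Polynomial.mem_roots'.mp hx).2
    simp only [hf, Polynomial.IsRoot, Polynomial.eval_add, Polynomial.eval_pow,
      Polynomial.eval_X, Polynomial.eval_C] at this
    linear_combination -this
  have : Fact (Irreducible f) := ⟨hirr⟩
  let L := AdjoinRoot f
  have hfd : FiniteDimensional K L := hmonic.finite_adjoinRoot
  have hNF : NumberField L := NumberField.of_module_finite K L
  have h2 : Module.finrank K L = 2 := by
    rw [(AdjoinRoot.powerBasis' hmonic).finrank, AdjoinRoot.powerBasis'_dim, hdeg]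
  let r : L := AdjoinRoot.root f
  have hr : r ^ 2 = -algebraMap K L T := by
    have h := AdjoinRoot.eval₂_root f
    simp only [hf, Polynomial.eval₂_add, Polynomial.eval₂_pow, Polynomial.eval₂_X,
      Polynomial.eval₂_C] at h
    exact eq_neg_of_add_eq_zero_left h
  have hrint : IsIntegral ℤ r := by
    apply IsIntegral.of_pow (n := 2) (by norm_num)
    rw [hr]
    exact (T.2.algebraMap).neg
  let θ : 𝓞 L := ⟨r, hrint⟩
  have hθ : θ ^ 2 = -algebraMap (𝓞 K) (𝓞 L) T := by
    apply RingOfIntegers.ext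
    exact hr
  let σ : L →ₐ[K] L := AdjoinRoot.liftAlgHom f (Algebra.ofId K L) (-r) (by
    simp only [hf, Polynomial.eval₂_add, Polynomial.eval₂_pow, Polynomial.eval₂_X,
      Polynomial.eval₂_C, neg_sq, hr]
    exact neg_add_cancel _)
  have hσr : σ r = -r := AdjoinRoot.liftAlgHom_root ..
  let τ : 𝓞 L →ₐ[𝓞 K] 𝓞 L := RingOfIntegers.mapAlgHom σ
  have hτ : τ θ = -θ := RingOfIntegers.ext hσr
  set S := (UniqueFactorizationMonoid.normalizedFactors
    (Ideal.span {2 * T} : Ideal (𝓞 K))).toFinset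
  obtain ⟨p, hp, hp0, hpS, huniq⟩ := exists_prime_not_split (L := L) h2 S (by
    intro p hp
    have hpr := UniqueFactorizationMonoid.prime_of_normalized_factor p (Multiset.mem_toFinset.mp hp)
    exact ⟨Ideal.isPrime_of_prime hpr, hpr.ne_zero⟩)
  have h2T : 2 * T ∉ p := by
    intro h
    apply hpS
    have hne : Ideal.span {2 * T} ≠ (0 : Ideal (𝓞 K)) := by simp [hT0]
    rw [Multiset.mem_toFinset, UniqueFactorizationMonoid.mem_normalizedFactors_iff' hne]
    refine ⟨(Ideal.prime_of_isPrime hp0 hp).irreducible, normalize_eq _, ?_⟩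
    exact Ideal.dvd_span_singleton.mpr h
  have hTp : T ∉ p := fun h => h2T (Ideal.mul_mem_left _ _ h)
  have h2p : (2 : 𝓞 K) ∉ p := fun h => h2T (Ideal.mul_mem_right _ _ h)
  refine ⟨p, hp, hp0, hTp, fun x hx => ?_⟩
  have hpm : p.IsMaximal := hp.isMaximal hp0
  obtain ⟨Q, hQm, hQp⟩ := Ideal.exists_maximal_ideal_liesOver_of_isIntegral (S := 𝓞 L) p
  have hmem : ∀ y : 𝓞 K, algebraMap (𝓞 K) (𝓞 L) y ∈ Q ↔ y ∈ p := fun y =>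
    (Ideal.mem_of_liesOver Q p y).symm
  have hQ' : Q.comap τ = Q := by
    have hlies : (Q.comap τ).LiesOver p := by
      refine ⟨?_⟩
      ext y
      rw [Ideal.under, Ideal.mem_comap, Ideal.mem_comap, AlgHom.commutes, hmem]
    exact huniq _ _ (Ideal.comap_isPrime τ Q) hQm.isPrime hlies hQp
  have hinv : ∀ z ∈ Q, τ z ∈ Q := fun z hz => by
    rw [← hQ'] at hz
    exact hz
  set X := algebraMap (𝓞 K) (𝓞 L) x
  have hτX : τ X = X := AlgHom.commutes _ _
  have hprod : (θ - X) * (θ + X) ∈ Q := by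
    have : (θ - X) * (θ + X) = -algebraMap (𝓞 K) (𝓞 L) (x ^ 2 + T) := by
      rw [map_add, map_pow]
      linear_combination hθ
    rw [this]
    exact Q.neg_mem ((hmem _).mpr hx)
  have h2X : algebraMap (𝓞 K) (𝓞 L) (2 * x) ∈ Q := by
    rw [map_mul, map_ofNat]
    rcases hQm.isPrime.mem_or_mem hprod with h | h
    · have h' := hinv _ h
      rw [map_sub, hτ, hτX] at h'
      have := Q.neg_mem (Q.add_mem h h')
      convert this using 1
      ring
    · have h' := hinv _ h
      rw [map_add, hτ, hτX] at h'
      have := Q.add_mem h h'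
      convert this using 1
      ring
  have hxp : x ∈ p := ((hp.mem_or_mem ((hmem _).mp h2X)).resolve_left h2p)
  apply hTp
  have := p.sub_mem hx (p.mul_mem_left x hxp)
  convert this using 1
  ring

/-- An element with prescribed simple vanishing at finitely many primes, totally positive. -/
lemma exists_totallyPositive_mem_notMem_sq {K : Type*} [Field K] [NumberField K]
    (S : Finset (Ideal (𝓞 K))) (hS : ∀ p ∈ S, p.IsPrime ∧ p ≠ ⊥) :
    ∃ a : 𝓞 K, (∀ σ : K →+* ℝ, 0 < σ a) ∧ ∀ p ∈ S, a ∈ p ∧ a ∉ p ^ 2 := by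
  classical
  have hex : ∀ p : S, ∃ y ∈ p.1, y ∉ p.1 ^ 2 := by
    intro p
    obtain ⟨hp, hp0⟩ := hS p.1 p.2
    have hlt : p.1 ^ 2 < p.1 := by
      simpa using Ideal.pow_right_strictAnti p.1 hp0 hp.ne_top one_lt_two
    exact SetLike.exists_of_lt hlt
  choose y hy hy2 using hex
  have hcop : Pairwise (Function.onFun IsCoprime fun p : S => p.1 ^ 2) := by
    intro p q hpq
    obtain ⟨hp, hp0⟩ := hS p.1 p.2
    obtain ⟨hq, hq0⟩ := hS q.1 q.2
    have := hp.isMaximal hp0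
    have := hq.isMaximal hq0
    exact (Ideal.isCoprime_of_isMaximal (fun h => hpq (Subtype.ext h))).pow
  obtain ⟨b, hb⟩ := Ideal.exists_forall_sub_mem_ideal hcop y
  set J : Ideal (𝓞 K) := ∏ p ∈ S, p ^ 2
  have hJ0 : J ≠ 0 := Finset.prod_ne_zero_iff.mpr fun p hp => pow_ne_zero 2 (hS p hp).2
  set m := Ideal.absNorm J
  have hm : 0 < m := Nat.pos_of_ne_zero (by rwa [Ne, Ideal.absNorm_eq_zero_iff])
  have hmJ : ∀ p ∈ S, ((m : ℕ) : 𝓞 K) ∈ p ^ 2 := fun p hp =>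
    Ideal.le_of_dvd (Finset.dvd_prod_of_mem _ hp) (Ideal.absNorm_mem J)
  have hfin : Finite (K →+* ℝ) := by
    have : Finite (K →+* ℂ) := inferInstance
    exact Finite.of_injective (fun σ : K →+* ℝ => Complex.ofRealHom.comp σ) fun σ τ h => by
      ext x
      have := RingHom.congr_fun h x
      exact Complex.ofReal_injective this
  obtain ⟨B, hB⟩ := (Set.finite_range fun σ : K →+* ℝ => -σ b).bddAbove
  obtain ⟨k, hk⟩ := exists_nat_gt B
  refine ⟨b + k * m, fun σ => ?_, fun p hp => ?_⟩
  · have h1 : -σ b ≤ B := hB ⟨σ, rfl⟩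
    have h2 : σ ((b + k * m : 𝓞 K) : K) = σ b + k * m := by simp
    rw [h2]
    have h3 : (1 : ℝ) ≤ m := by exact_mod_cast hm
    have h4 : (0 : ℝ) ≤ k := by positivity
    nlinarith
  · have hkm : (k * m : 𝓞 K) ∈ p ^ 2 := Ideal.mul_mem_left _ _ (hmJ p hp)
    have hle : p ^ 2 ≤ p := Ideal.pow_le_self two_ne_zero
    have hbp := hb ⟨p, hp⟩
    have hsum : b + k * m - y ⟨p, hp⟩ ∈ p ^ 2 := by
      have := Ideal.add_mem _ hbp hkm
      convert this using 1
      ring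
    constructor
    · exact (Submodule.sub_mem_iff_left _ (hy ⟨p, hp⟩)).mp (hle hsum)
    · intro h
      exact hy2 ⟨p, hp⟩ ((Submodule.sub_mem_iff_right _ h).mp hsum)

/-- A hyperbolic plane forces the discriminant: if a diagonal form of rank at most `n + 2` over a
field contains a nonzero isotropic vector orthogonal to `n` pairwise orthogonal vectors of length
`t ^ 2 ≠ 0`, then minus its discriminant is a square. -/
lemma isSquare_neg_prod_of_isotropic {k J : Type*} [Field k] [Fintype J] [DecidableEq J] {n : ℕ}
    (hJ : Fintype.card J ≤ n + 2) (q : J → k) (hq : ∀ j, q j ≠ 0) (t : k) (ht : t ≠ 0)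
    (x : J → k) (hx : x ≠ 0) (f : Fin n → J → k)
    (hxx : ∑ j, x j * q j * x j = 0) (hxf : ∀ i, ∑ j, x j * q j * f i j = 0)
    (hff : ∀ i i', ∑ j, f i j * q j * f i' j = if i = i' then t ^ 2 else 0) :
    IsSquare (-∏ j, q j) := by
  let D : Matrix J J k := Matrix.diagonal q
  let b : (J → k) → (J → k) → k := fun u v => ∑ j, u j * q j * v j
  have hbsymm : ∀ u v, b u v = b v u := fun u v =>
    Finset.sum_congr rfl fun j _ => by ring
  obtain ⟨j₀, hj₀⟩ := Function.ne_iff.mp hx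
  let y₀ : J → k := Pi.single j₀ (x j₀ * q j₀)⁻¹
  have hxy₀ : b x y₀ = 1 := by
    simp only [b, y₀]
    rw [Finset.sum_eq_single j₀]
    · rw [Pi.single_eq_same]
      exact mul_inv_cancel₀ (mul_ne_zero hj₀ (hq j₀))
    · intro j _ hj
      rw [Pi.single_eq_of_ne hj, mul_zero]
    · simp
  let y : J → k := fun j => y₀ j - ∑ i, (b y₀ (f i) / t ^ 2) * f i j
  have hby : ∀ v, b v y = b v y₀ - ∑ i, (b y₀ (f i) / t ^ 2) * b v (f i) := by
    intro v
    simp only [b, y, mul_sub, Finset.sum_sub_distrib, Finset.mul_sum]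
    rw [Finset.sum_comm]
    congr 1
    refine Finset.sum_congr rfl fun i _ => Finset.sum_congr rfl fun j _ => by ring
  have hxy : b x y = 1 := by
    rw [hby, hxy₀]
    simp [b, hxf]
  have hfy : ∀ i, b (f i) y = 0 := by
    intro i
    rw [hby, hbsymm]
    simp only [b] at hff ⊢
    simp only [hff]
    simp [div_mul_cancel₀ _ (pow_ne_zero 2 ht)]
  let C : Matrix (Fin 2 ⊕ Fin n) J k := Matrix.of (Sum.elim ![x, y] f)
  let E : Matrix (Fin 2 ⊕ Fin n) (Fin 2 ⊕ Fin n) k :=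
    Matrix.fromBlocks !![0, 1; 1, b y y] 0 0 (Matrix.diagonal fun _ => t ^ 2)
  have hCE : C * D * C.transpose = E := by
    have hentry : ∀ u v, (C * D * C.transpose) u v = b (C u) (C v) := by
      intro u v
      rw [Matrix.mul_apply]
      simp only [D, Matrix.mul_diagonal, Matrix.transpose_apply, b]
    ext u v
    rw [hentry]
    rcases u with u | u <;> rcases v with v | v
    · fin_cases u <;> fin_cases v
      · exact hxx
      · exact hxy
      · exact (hbsymm _ _).trans hxy
      · rfl
    · fin_cases u
      · exact hxf v
      · exact (hbsymm _ _).trans (hfy v)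
    · fin_cases v
      · exact (hbsymm _ _).trans (hxf u)
      · exact hfy u
    · refine (hff u v).trans ?_
      simp [E, Matrix.diagonal_apply]
  have hEdet : E.det = -(t ^ n) ^ 2 := by
    rw [Matrix.det_fromBlocks_zero₂₁, Matrix.det_fin_two_of, Matrix.det_diagonal]
    simp
    ring
  have hE0 : E.det ≠ 0 := by
    rw [hEdet]
    exact neg_ne_zero.mpr (pow_ne_zero _ (pow_ne_zero _ ht))
  have hcard : Fintype.card J = Fintype.card (Fin 2 ⊕ Fin n) := by
    have h1 : E.rank = Fintype.card (Fin 2 ⊕ Fin n) :=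
      Matrix.rank_of_isUnit E ((Matrix.isUnit_iff_isUnit_det E).mpr hE0.isUnit)
    have h2 : E.rank ≤ Fintype.card J := by
      rw [← hCE, Matrix.mul_assoc]
      exact (Matrix.rank_mul_le_left _ _).trans (Matrix.rank_le_card_width _)
    have h3 : Fintype.card (Fin 2 ⊕ Fin n) = n + 2 := by simp [add_comm]
    omega
  let e : (Fin 2 ⊕ Fin n) ≃ J := (Fintype.equivOfCardEq hcard).symm
  have hCe : C.submatrix id e * D.submatrix e e * (C.submatrix id e).transpose = E := by
    rw [Matrix.submatrix_mul_equiv, Matrix.transpose_submatrix, Matrix.submatrix_mul_equiv, hCE]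
    rfl
  have hdet := congrArg Matrix.det hCe
  rw [Matrix.det_mul, Matrix.det_mul, Matrix.det_transpose, Matrix.det_submatrix_equiv_self,
    Matrix.det_diagonal, hEdet] at hdet
  set d := (C.submatrix id e).det
  have hd : d ≠ 0 := by
    rintro hd
    rw [hd] at hdet
    apply pow_ne_zero 2 (pow_ne_zero n ht)
    linear_combination hdet
  refine ⟨t ^ n / d, ?_⟩
  field_simp
  linear_combination -hdet

namespace OKLattice

variable {K : Type} [Field K]

lemma form_self_ne_zero (L : OKLattice K) (σ : K →+* ℝ) {v : L.carrier} (hv : v ≠ 0) :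
    L.form v v ≠ 0 := by
  intro h
  have := L.posDef v hv σ
  rw [h, map_zero, map_zero] at this
  exact this.false

lemma rank_eq_finrank [NumberField K] (L : OKLattice K) :
    L.rank = Module.finrank (𝓞 K) L.carrier :=
  (TensorProduct.isBaseChange (𝓞 K) L.carrier K).finrank_eq

lemma card_le_rank_of_orthogonal [NumberField K] (L : OKLattice K) (σ : K →+* ℝ) {r : ℕ}
    (b : Fin r → L.carrier) (hb : ∀ i, b i ≠ 0) (horth : ∀ i j, i ≠ j → L.form (b i) (b j) = 0) :
    r ≤ L.rank := by
  have hli : LinearIndependent (𝓞 K) b := by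
    rw [Fintype.linearIndependent_iff]
    intro g hg i
    have h := congrArg (fun v => L.form v (b i)) hg
    simp only [map_sum, map_smul, LinearMap.sum_apply, LinearMap.smul_apply, map_zero,
      LinearMap.zero_apply, smul_eq_mul] at h
    rw [Finset.sum_eq_single i (fun j _ hj => by rw [horth j i hj, mul_zero]) (by simp)] at h
    exact (mul_eq_zero.mp h).resolve_right (L.form_self_ne_zero σ (hb i))
  rw [rank_eq_finrank]
  simpa using hli.fintype_card_le_finrank

lemma exists_maximal_orthogonal [NumberField K] (L : OKLattice K) (σ : K →+* ℝ) :
    ∃ r ≤ L.rank, ∃ b : Fin r → L.carrier, (∀ i, b i ≠ 0) ∧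
      (∀ i j, i ≠ j → L.form (b i) (b j) = 0) ∧
      ∀ x, (∀ i, L.form x (b i) = 0) → x = 0 := by
  classical
  let P : ℕ → Prop := fun r => ∃ b : Fin r → L.carrier, (∀ i, b i ≠ 0) ∧
      ∀ i j, i ≠ j → L.form (b i) (b j) = 0
  have hP : ∀ r, P r → r ≤ L.rank := fun r ⟨b, h1, h2⟩ => L.card_le_rank_of_orthogonal σ b h1 h2
  have hP0 : P 0 := ⟨Fin.elim0, fun i => i.elim0, fun i => i.elim0⟩
  obtain ⟨b, hb, horth⟩ : P (Nat.findGreatest P L.rank) :=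
    Nat.findGreatest_spec (Nat.zero_le _) hP0
  refine ⟨_, Nat.findGreatest_le _, b, hb, horth, fun x hx => ?_⟩
  by_contra hx0
  have hnext : P (Nat.findGreatest P L.rank + 1) := by
    refine ⟨Fin.cons x b, fun i => ?_, fun i j hij => ?_⟩
    · refine Fin.cases ?_ (fun i => ?_) i
      · exact hx0
      · exact hb i
    · revert hij
      refine Fin.cases ?_ (fun i => ?_) i <;> refine Fin.cases ?_ (fun j => ?_) j
      · intro h; exact absurd rfl h
      · intro _; exact hx j
      · intro _; exact (L.symm _ _).trans (hx i)
      · intro h; exact horth i j fun hh => h (by rw [hh])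
  have := Nat.le_findGreatest (hP _ hnext) hnext
  omega

/-- The diagonal lattice with totally positive entries `w`. -/
def diagonal {ι : Type} [Fintype ι] (w : ι → 𝓞 K) (hw : ∀ i, ∀ σ : K →+* ℝ, 0 < σ (w i)) :
    OKLattice K where
  carrier := ι → 𝓞 K
  form := LinearMap.mk₂ (𝓞 K) (fun x y => ∑ i, w i * x i * y i)
    (fun x x' y => by simp only [Pi.add_apply, mul_add, add_mul, Finset.sum_add_distrib])
    (fun c x y => by
      simp only [Pi.smul_apply, smul_eq_mul, Finset.mul_sum]
      exact Finset.sum_congr rfl fun i _ => by ring)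
    (fun x y y' => by simp only [Pi.add_apply, mul_add, Finset.sum_add_distrib])
    (fun c x y => by
      simp only [Pi.smul_apply, smul_eq_mul, Finset.mul_sum]
      exact Finset.sum_congr rfl fun i _ => by ring)
  symm x y := by
    simp only [LinearMap.mk₂_apply]
    exact Finset.sum_congr rfl fun i _ => by ring
  posDef v hv σ := by
    simp only [LinearMap.mk₂_apply, map_sum, map_mul]
    obtain ⟨i, hi⟩ := Function.ne_iff.mp hv
    have hterm : ∀ j, σ (algebraMap (𝓞 K) K (w j)) * σ (algebraMap (𝓞 K) K (v j)) *
        σ (algebraMap (𝓞 K) K (v j)) = σ (w j) * σ (algebraMap (𝓞 K) K (v j)) ^ 2 := fun j => by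
      rw [mul_assoc, ← sq]
    simp_rw [hterm]
    refine Finset.sum_pos' (fun j _ => mul_nonneg (hw j σ).le (sq_nonneg _))
      ⟨i, Finset.mem_univ i, mul_pos (hw i σ) (sq_pos_of_ne_zero ?_)⟩
    rw [Ne, map_eq_zero, RingOfIntegers.coe_eq_zero_iff]
    exact hi

lemma diagonal_form_single {ι : Type} [Fintype ι] [DecidableEq ι] (w : ι → 𝓞 K)
    (hw : ∀ i, ∀ σ : K →+* ℝ, 0 < σ (w i)) (i j : ι) :
    (diagonal w hw).form (Pi.single i 1 : ι → 𝓞 K) (Pi.single j 1 : ι → 𝓞 K) =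
      if i = j then w i else 0 := by
  change ∑ l, w l * (Pi.single i 1 : ι → 𝓞 K) l * (Pi.single j 1 : ι → 𝓞 K) l = _
  rw [Finset.sum_eq_single i]
  · by_cases h : i = j
    · subst h; simp
    · simp [h]
  · intro l _ hl
    simp [Pi.single_eq_of_ne hl]
  · simp

lemma rank_diagonal {n : ℕ} (w : Fin n → 𝓞 K) (hw : ∀ i, ∀ σ : K →+* ℝ, 0 < σ (w i)) :
    (diagonal w hw).rank = n := by
  unfold rank
  change Module.finrank K (K ⊗[𝓞 K] (Fin n → 𝓞 K)) = n
  rw [Module.finrank_baseChange, Module.finrank_fin_fun]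

lemma form_map_eq [NumberField K] {L M : OKLattice K} (f : M.carrier →ₗ[𝓞 K] L.carrier)
    (hf : ∀ x, L.form (f x) (f x) = M.form x x) (x y : M.carrier) :
    L.form (f x) (f y) = M.form x y := by
  have h := hf (x + y)
  simp only [map_add, LinearMap.add_apply, hf] at h
  rw [L.symm (f y) (f x), M.symm y x] at h
  have h2 : (2 : 𝓞 K) * (L.form (f x) (f y) - M.form x y) = 0 := by linear_combination h
  exact sub_eq_zero.mp ((mul_eq_zero.mp h2).resolve_left two_ne_zero)

/-- If `-T` is a nonsquare modulo `p`, where `T` is the discriminant of an orthogonal frame of `L`,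
then `L` does not represent `⟨a, 1, …, 1⟩` when `a` vanishes to order exactly one at `p`. -/
lemma not_represents_diagonal_cons [NumberField K] {L : OKLattice K} {n r : ℕ} (hr : r ≤ n + 2)
    (b : Fin r → L.carrier) (horth : ∀ i j, i ≠ j → L.form (b i) (b j) = 0)
    (hmax : ∀ x, (∀ i, L.form x (b i) = 0) → x = 0)
    {p : Ideal (𝓞 K)} (hp : p.IsPrime) (hp0 : p ≠ ⊥) (hT : ∏ j, L.form (b j) (b j) ∉ p)
    (hsq : ∀ x : 𝓞 K, x ^ 2 + ∏ j, L.form (b j) (b j) ∉ p)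
    {a : 𝓞 K} (ha : a ∈ p) (ha2 : a ∉ p ^ 2)
    (hw : ∀ i, ∀ σ : K →+* ℝ, 0 < σ ((Fin.cons a (fun _ => 1) : Fin (n + 1) → 𝓞 K) i)) :
    ¬ L.Represents (diagonal (Fin.cons a (fun _ => 1) : Fin (n + 1) → 𝓞 K) hw) := by
  rintro ⟨φ, hφ⟩
  set w : Fin (n + 1) → 𝓞 K := Fin.cons a (fun _ => 1)
  set q : Fin r → 𝓞 K := fun j => L.form (b j) (b j)
  set T := ∏ j, q j
  let f : Fin (n + 1) → L.carrier := fun i => φ (Pi.single i 1 : Fin (n + 1) → 𝓞 K)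
  have hf : ∀ i j, L.form (f i) (f j) = if i = j then w i else 0 := fun i j =>
    (form_map_eq φ hφ _ _).trans (diagonal_form_single w hw i j)
  let c : Fin (n + 1) → Fin r → 𝓞 K := fun i j =>
    (∏ l ∈ Finset.univ.erase j, q l) * L.form (f i) (b j)
  have hcq : ∀ i j, c i j * q j = T * L.form (f i) (b j) := by
    intro i j
    have : q j * ∏ l ∈ Finset.univ.erase j, q l = T :=
      Finset.mul_prod_erase _ _ (Finset.mem_univ j)
    rw [← this]
    ring
  have hTf : ∀ i, T • f i = ∑ j, c i j • b j := by
    intro i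
    rw [← sub_eq_zero]
    refine hmax _ fun l => ?_
    simp only [map_sub, map_smul, map_sum, LinearMap.sub_apply, LinearMap.smul_apply,
      LinearMap.sum_apply, smul_eq_mul]
    rw [Finset.sum_eq_single l (fun j _ hj => by rw [horth j l hj, mul_zero]) (by simp)]
    exact sub_eq_zero.mpr (hcq i l).symm
  have hgram : ∀ i i', ∑ j, c i j * q j * c i' j = T ^ 2 * if i = i' then w i else 0 := by
    intro i i'
    have h : L.form (T • f i) (T • f i') = T ^ 2 * if i = i' then w i else 0 := by
      simp only [map_smul, LinearMap.smul_apply, smul_eq_mul, hf]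
      ring
    rw [← h, hTf i']
    simp only [map_smul, LinearMap.smul_apply, map_sum, smul_eq_mul]
    exact Finset.sum_congr rfl fun j _ => by rw [hcq]; ring
  have hpm : p.IsMaximal := hp.isMaximal hp0
  let : Field (𝓞 K ⧸ p) := Ideal.Quotient.field p
  let π := Ideal.Quotient.mk p
  have hπ : ∀ z, π z = 0 ↔ z ∈ p := fun z => Ideal.Quotient.eq_zero_iff_mem
  have hgram' : ∀ i i', ∑ j, π (c i j) * π (q j) * π (c i' j) =
      π T ^ 2 * if i = i' then π (w i) else 0 := by
    intro i i'
    have := congrArg π (hgram i i')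
    simp only [map_sum, map_mul, map_pow] at this
    rw [this]
    split_ifs <;> simp
  have hx : (fun j => π (c 0 j)) ≠ 0 := by
    intro h
    have hc : ∀ j, c 0 j ∈ p := fun j => (hπ _).mp (congrFun h j)
    have h1 : T ^ 2 * a ∈ p ^ 2 := by
      have := hgram 0 0
      rw [if_pos rfl] at this
      change _ = T ^ 2 * a at this
      rw [← this]
      refine Ideal.sum_mem _ fun j _ => ?_
      rw [sq, mul_assoc]
      exact Ideal.mul_mem_mul (hc j) (p.mul_mem_left _ (hc j))
    rcases Ideal.IsMaximal.mul_mem_pow p h1 with h2 | h2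
    · exact hT (hp.mem_of_pow_mem 2 h2)
    · exact ha2 h2
  have hqp : ∀ j, π (q j) ≠ 0 := fun j h =>
    hT (p.mem_of_dvd (Finset.dvd_prod_of_mem q (Finset.mem_univ j)) ((hπ _).mp h))
  have hs := isSquare_neg_prod_of_isotropic (n := n) (by simpa using hr) (fun j => π (q j)) hqp
    (π T) (fun h => hT ((hπ _).mp h)) (fun j => π (c 0 j)) hx (fun i j => π (c i.succ j))
    (by
      rw [hgram', if_pos rfl]
      have : π (w 0) = 0 := (hπ _).mpr ha
      rw [this, mul_zero])
    (fun i => by rw [hgram', if_neg (Fin.succ_ne_zero i).symm, mul_zero])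
    (fun i i' => by
      rw [hgram']
      have : π (w i.succ) = 1 := map_one π
      simp only [Fin.succ_inj, this, mul_ite, mul_one, mul_zero])
  obtain ⟨z, hz⟩ := hs
  obtain ⟨z, rfl⟩ := Ideal.Quotient.mk_surjective z
  apply hsq z
  rw [← hπ, map_add, map_pow]
  change π z ^ 2 + π (∏ j, q j) = 0
  rw [map_prod]
  change -∏ j, π (q j) = π z * π z at hz
  linear_combination -hz

end OKLattice

lemma TotallyReal.exists_ringHom_real {K : Type} [Field K] [NumberField K] (h : TotallyReal K) :
    Nonempty (K →+* ℝ) := by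
  obtain ⟨φ⟩ : Nonempty (K →+* ℂ) := inferInstance
  exact ⟨{ toFun := fun x => (φ x).re
           map_zero' := by simp
           map_one' := by simp
           map_add' := fun x y => by simp
           map_mul' := fun x y => by simp [h φ] }⟩

theorem stmt8 (K : Type) [Field K] [NumberField K] (htr : TotallyReal K)
    (n m : ℕ) (hn : 1 ≤ n) (hm : 1 ≤ m) (hmn : m ≤ n + 1)
    (s : ℕ) (Ls : Fin s → OKLattice K) (hrank : ∀ i, (Ls i).rank = m) :
    ∃ M : OKLattice K, M.rank = n ∧ ∀ i, ¬ (Ls i).Represents M := by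
  classical
  obtain ⟨σ⟩ := htr.exists_ringHom_real
  obtain ⟨n, rfl⟩ : ∃ n', n = n' + 1 := ⟨n - 1, by omega⟩
  choose r hr b hb horth hmax using fun i => (Ls i).exists_maximal_orthogonal σ
  have hprime : ∀ i, ∃ p : Ideal (𝓞 K), p.IsPrime ∧ p ≠ ⊥ ∧
      (∏ j, (Ls i).form (b i j) (b i j)) ∉ p ∧
      ∀ x : 𝓞 K, x ^ 2 + (∏ j, (Ls i).form (b i j) (b i j)) ∉ p := by
    intro i
    obtain ⟨p, h1, h2, h3, h4⟩ := exists_prime_forall_sq_add_notMem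
      (∏ j, (Ls i).form (b i j) (b i j)) (by
        rintro ⟨z, hz⟩
        have hpos : 0 < σ ((∏ j, (Ls i).form (b i j) (b i j) : 𝓞 K) : K) := by
          rw [RingOfIntegers.coe_eq_algebraMap, map_prod, map_prod]
          exact Finset.prod_pos fun j _ => (Ls i).posDef _ (hb i j) σ
        have h := congrArg σ hz
        rw [map_neg, map_mul] at h
        nlinarith [mul_self_nonneg (σ z)])
    exact ⟨p, h1, h2, h3, h4⟩
  choose p hp hp0 hT hsq using hprime
  obtain ⟨a, ha, hap⟩ := exists_totallyPositive_mem_notMem_sq (Finset.univ.image p) (by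
    intro P hP
    obtain ⟨i, -, rfl⟩ := Finset.mem_image.mp hP
    exact ⟨hp i, hp0 i⟩)
  have hw : ∀ i, ∀ τ : K →+* ℝ,
      0 < τ ((Fin.cons a (fun _ => 1) : Fin (n + 1) → 𝓞 K) i) := by
    intro i τ
    refine Fin.cases ?_ (fun i => ?_) i
    · exact ha τ
    · simp
  refine ⟨OKLattice.diagonal _ hw, OKLattice.rank_diagonal _ hw, fun i => ?_⟩
  obtain ⟨h1, h2⟩ := hap (p i) (Finset.mem_image_of_mem p (Finset.mem_univ i))
  exact OKLattice.not_represents_diagonal_cons ((hr i).trans (by rw [hrank i]; omega)) (b i)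
    (horth i) (hmax i) (hp i) (hp0 i) (hT i) (hsq i) h1 h2 hw
end
end

section
/- Let K be a totally real number field and let 𝔭 be a dyadic maximal ideal of O_K. Let A ∈ M_n(K_𝔭) be a symmetric matrix with det A ≠ 0. Then ord_𝔭(det A) is even if and only if there exists an invertible matrix P ∈ GL_n(K_𝔭) such that all entries of Pᵀ A P lie in O_𝔭 and det(Pᵀ A P) is a unit of O_𝔭. -/
open NumberField IsDedekindDomain Matrix

noncomputable section

section UnimodularLattices

open WithZero

variable {F ι κ : Type*} [Field F] [Fintype ι] [DecidableEq ι] [Fintype κ] [DecidableEq κ]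
  (v : Valuation F ℤᵐ⁰)

/-- The symmetric bilinear space with Gram matrix `A` contains a unimodular lattice over the
valuation ring of `v`. -/
def HasUnimodularLattice (A : Matrix ι ι F) : Prop :=
  ∃ P : Matrix ι ι F, P.det ≠ 0 ∧ (∀ i j, v ((Pᵀ * A * P) i j) ≤ 1) ∧ v (Pᵀ * A * P).det = 1

variable {v}

lemma HasUnimodularLattice.of_congr {A : Matrix ι ι F} (Q : Matrix ι ι F) (hQ : Q.det ≠ 0)
    (h : HasUnimodularLattice v (Qᵀ * A * Q)) : HasUnimodularLattice v A := by
  obtain ⟨P, hP, hint, hdet⟩ := h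
  have e : (Q * P)ᵀ * A * (Q * P) = Pᵀ * (Qᵀ * A * Q) * P := by
    simp only [transpose_mul, Matrix.mul_assoc]
  exact ⟨Q * P, by simpa using ⟨hQ, hP⟩, by simpa only [e] using hint, by simpa only [e] using hdet⟩

lemma HasUnimodularLattice.fromBlocks {A : Matrix ι ι F} {B : Matrix κ κ F}
    (hA : HasUnimodularLattice v A) (hB : HasUnimodularLattice v B) :
    HasUnimodularLattice v (Matrix.fromBlocks A 0 0 B) := by
  obtain ⟨P, hP, hPint, hPdet⟩ := hA
  obtain ⟨Q, hQ, hQint, hQdet⟩ := hB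
  have e : (Matrix.fromBlocks P 0 0 Q)ᵀ * Matrix.fromBlocks A 0 0 B * Matrix.fromBlocks P 0 0 Q =
      Matrix.fromBlocks (Pᵀ * A * P) 0 0 (Qᵀ * B * Q) := by
    simp [fromBlocks_transpose, fromBlocks_multiply]
  refine ⟨Matrix.fromBlocks P 0 0 Q, ?_, ?_, ?_⟩
  · rw [det_fromBlocks_zero₂₁]
    exact mul_ne_zero hP hQ
  · rw [e]
    rintro (i | i) (j | j)
    · exact hPint i j
    · simp
    · simp
    · exact hQint i j
  · rw [e, det_fromBlocks_zero₂₁, map_mul, hPdet, hQdet, one_mul]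

lemma HasUnimodularLattice.submatrix {A : Matrix ι ι F} (e : κ ≃ ι)
    (h : HasUnimodularLattice v A) : HasUnimodularLattice v (A.submatrix e e) := by
  obtain ⟨P, hP, hint, hdet⟩ := h
  have e' : (P.submatrix e e)ᵀ * A.submatrix e e * P.submatrix e e =
      (Pᵀ * A * P).submatrix e e := by
    simp only [transpose_submatrix, submatrix_mul_equiv]
  refine ⟨P.submatrix e e, by rwa [det_submatrix_equiv_self], ?_, ?_⟩
  · intro i j
    rw [e']
    exact hint _ _
  · rwa [e', det_submatrix_equiv_self]

lemma HasUnimodularLattice.diagonal_comp_equiv_iff (e : κ ≃ ι) {d : ι → F} :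
    HasUnimodularLattice v (diagonal (d ∘ e)) ↔ HasUnimodularLattice v (diagonal d) := by
  refine ⟨fun h ↦ ?_, fun h ↦ ?_⟩
  · simpa [submatrix_diagonal_equiv, Function.comp_assoc] using h.submatrix e.symm
  · simpa [submatrix_diagonal_equiv] using h.submatrix e

lemma HasUnimodularLattice.diagonal_of_subtypes (p : ι → Prop) [DecidablePred p] {d : ι → F}
    (h₁ : HasUnimodularLattice v (diagonal fun i : {i // p i} ↦ d i))
    (h₂ : HasUnimodularLattice v (diagonal fun i : {i // ¬ p i} ↦ d i)) :
    HasUnimodularLattice v (diagonal d) := by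
  rw [← HasUnimodularLattice.diagonal_comp_equiv_iff (Equiv.sumCompl p)]
  have h := h₁.fromBlocks h₂
  rw [fromBlocks_diagonal] at h
  convert h using 2
  ext (i | i) <;> simp

lemma map_det_transpose_mul_mul (A P : Matrix ι ι F) :
    v (Pᵀ * A * P).det = v P.det ^ 2 * v A.det := by
  simp only [det_mul, det_transpose, map_mul, pow_two]
  ac_rfl

lemma hasUnimodularLattice_diagonal_of_subsingleton [Subsingleton ι]
    (hsurj : Function.Surjective v) {d : ι → F} (hd : ∀ i, d i ≠ 0)
    (heven : ∀ i, Even (log (v (d i)))) : HasUnimodularLattice v (diagonal d) := by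
  have hx : ∀ i, ∃ x, v (d i) = (v x ^ 2)⁻¹ ∧ x ≠ 0 := by
    intro i
    obtain ⟨k, hk⟩ := heven i
    obtain ⟨x, hx⟩ := hsurj (exp (-k))
    refine ⟨x, ?_, fun h ↦ exp_ne_zero (by rw [← hx, h, map_zero])⟩
    rw [← exp_log ((v.ne_zero_iff).2 (hd i)), hk, hx]
    simp [pow_two]
  choose x hx hx0 using hx
  have hv : ∀ i, v (x i * d i * x i) = 1 := by
    intro i
    have := (v.ne_zero_iff).2 (hx0 i)
    rw [map_mul, map_mul, hx]
    field_simp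
  refine ⟨diagonal x, by simpa [det_diagonal, Finset.prod_ne_zero_iff] using hx0, ?_, ?_⟩
  · intro i j
    obtain rfl := Subsingleton.elim i j
    simpa using (hv i).le
  · simp only [diagonal_transpose, diagonal_mul_diagonal, det_diagonal, map_prod, hv,
      Finset.prod_const_one]

lemma exists_map_mul_sq_eq_exp_neg_one (hsurj : Function.Surjective v) {a : F} (ha : a ≠ 0)
    (hodd : Odd (log (v a))) : ∃ x, v (a * x ^ 2) = exp (-1 : ℤ) := by
  obtain ⟨k, hk⟩ := hodd
  obtain ⟨x, hx⟩ := hsurj (exp (-k - 1))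
  refine ⟨x, ?_⟩
  rw [map_mul, map_pow, hx, ← exp_log ((v.ne_zero_iff).2 ha), hk, ← WithZero.exp_nsmul,
    ← WithZero.exp_add]
  congr 1
  simp
  ring

lemma hasUnimodularLattice_diagonal_fin_two (hsurj : Function.Surjective v)
    (hsq : ∀ t, v t = 1 → ∃ s, v (t + s ^ 2) < 1) {d : Fin 2 → F} (hd : ∀ i, d i ≠ 0)
    (hodd : ∀ i, Odd (log (v (d i)))) : HasUnimodularLattice v (diagonal d) := by
  obtain ⟨x, hx⟩ := exists_map_mul_sq_eq_exp_neg_one hsurj (hd 0) (hodd 0)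
  obtain ⟨y, hy⟩ := exists_map_mul_sq_eq_exp_neg_one hsurj (hd 1) (hodd 1)
  obtain ⟨π, hπ⟩ := hsurj (exp (-1))
  have hx0 : d 0 * x ^ 2 ≠ 0 := fun h ↦ exp_ne_zero (by rw [← hx, h, map_zero])
  have hy0 : d 1 * y ^ 2 ≠ 0 := fun h ↦ exp_ne_zero (by rw [← hy, h, map_zero])
  have hπ0 : π ≠ 0 := fun h ↦ exp_ne_zero (by rw [← hπ, h, map_zero])
  have hx1 : x ≠ 0 := by rintro rfl; simp at hx0
  have hy1 : y ≠ 0 := by rintro rfl; simp at hy0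
  have hd1 := hd 1
  set t := d 0 * x ^ 2 / (d 1 * y ^ 2) with ht
  have hvt : v t = 1 := by rw [ht, map_div₀, hx, hy, div_self exp_ne_zero]
  obtain ⟨s, hs⟩ := hsq t hvt
  have hs1 : v s ≤ 1 := by
    have h : v (s ^ 2) ≤ 1 := by
      have := v.map_sub_le hs.le hvt.le
      rwa [add_sub_cancel_left] at this
    rw [map_pow] at h
    exact (pow_le_one_iff two_ne_zero).1 h
  have hs2 : v (t + s ^ 2) ≤ exp (-1) := by
    rw [← lt_mul_exp_iff_le exp_ne_zero, ← WithZero.exp_add]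
    simpa using hs
  let P : Matrix (Fin 2) (Fin 2) F := !![x / π, 0; s * y / π, y]
  have h00 : v (d 1 * y ^ 2 * (t + s ^ 2) / π ^ 2) ≤ 1 := by
    rw [map_div₀, map_mul, hy, map_pow, hπ]
    refine div_le_one_of_le₀ ?_ zero_le
    rw [pow_two (exp _)]
    exact mul_le_mul_right hs2 _
  have h01 : v (d 1 * y ^ 2 * s / π) ≤ 1 := by
    rw [map_div₀, map_mul, hy, hπ, mul_div_cancel_left₀ _ exp_ne_zero]
    exact hs1
  have h11 : v (d 1 * y ^ 2) ≤ 1 := by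
    rw [hy, ← exp_zero, exp_le_exp]
    norm_num
  have hdetP : P.det = x * y / π := by
    simp [P, det_fin_two]
    ring
  have hmul : Pᵀ * diagonal d * P = !![d 1 * y ^ 2 * (t + s ^ 2) / π ^ 2, d 1 * y ^ 2 * s / π;
      d 1 * y ^ 2 * s / π, d 1 * y ^ 2] := by
    ext i j
    fin_cases i <;> fin_cases j <;>
      simp [P, Matrix.mul_apply, Fin.sum_univ_two, diagonal_apply, ht] <;> field_simp
  refine ⟨P, ?_, ?_, ?_⟩
  · rw [hdetP]
    positivity
  · rw [hmul]
    intro i j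
    fin_cases i <;> fin_cases j
    exacts [h00, h01, h01, h11]
  · have : (Pᵀ * diagonal d * P).det = (d 0 * x ^ 2 / π) * (d 1 * y ^ 2 / π) := by
      simp only [det_mul, det_transpose, hdetP, det_diagonal, Fin.prod_univ_two]
      ring
    rw [this, map_mul, map_div₀, map_div₀, hx, hy, hπ, div_self exp_ne_zero, one_mul]

lemma log_map_mul {a b : F} (ha : a ≠ 0) (hb : b ≠ 0) :
    log (v (a * b)) = log (v a) + log (v b) := by
  rw [map_mul, log_mul ((v.ne_zero_iff).2 ha) ((v.ne_zero_iff).2 hb)]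

lemma hasUnimodularLattice_diagonal (hsurj : Function.Surjective v)
    (hsq : ∀ t, v t = 1 → ∃ s, v (t + s ^ 2) < 1) {d : ι → F} (hd : ∀ i, d i ≠ 0)
    (heven : Even (log (v (∏ i, d i)))) : HasUnimodularLattice v (diagonal d) := by
  induction h : Fintype.card ι using Nat.strong_induction_on generalizing ι with
  | _ n ih =>
  have hsplit : ∀ p : ι → Prop, [DecidablePred p] → (∃ i, p i) →
      Even (log (v (∏ i : {i // p i}, d i))) →
      HasUnimodularLattice v (diagonal fun i : {i // p i} ↦ d i) →
      HasUnimodularLattice v (diagonal d) := by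
    intro p _ ⟨i, hi⟩ hev hp
    refine hp.diagonal_of_subtypes p (ih _ ?_ (fun i ↦ hd i) ?_ rfl)
    · rw [← h]
      exact Fintype.card_subtype_lt (x := i) (not_not.2 hi)
    · have h₁ : ∏ i : {i // p i}, d i ≠ 0 := Finset.prod_ne_zero_iff.2 fun i _ ↦ hd i
      have h₂ : ∏ i : {i // ¬ p i}, d i ≠ 0 := Finset.prod_ne_zero_iff.2 fun i _ ↦ hd i
      rw [← Fintype.prod_subtype_mul_prod_subtype p, log_map_mul h₁ h₂, Int.even_add] at heven
      exact heven.1 hev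
  by_cases hex : ∃ i, Even (log (v (d i)))
  · obtain ⟨i, hi⟩ := hex
    refine hsplit (· = i) ⟨i, rfl⟩ ?_ ?_
    · simp only [Finset.univ_unique, Finset.prod_singleton]
      exact hi
    · have : HasUnimodularLattice v (diagonal fun j : {j // j = i} ↦ d j) := by
        refine hasUnimodularLattice_diagonal_of_subsingleton hsurj (fun j ↦ hd j) ?_
        rintro ⟨j, rfl⟩
        exact hi
      convert this
  · simp only [not_exists, Int.not_even_iff_odd] at hex
    rcases isEmpty_or_nonempty ι with hι | ⟨⟨i⟩⟩
    · exact hasUnimodularLattice_diagonal_of_subsingleton hsurj hd isEmptyElim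
    obtain ⟨j, hj⟩ : ∃ j, j ≠ i := by
      by_contra! hall
      have : Unique ι := ⟨⟨i⟩, hall⟩
      rw [Fintype.prod_unique] at heven
      exact Int.not_even_iff_odd.2 (hex _) heven
    let e : Fin 2 ≃ {k // k = i ∨ k = j} :=
      (Fintype.equivFinOfCardEq (Fintype.card_subtype_eq_or_eq_of_ne hj.symm)).symm
    refine hsplit (fun k ↦ k = i ∨ k = j) ⟨i, .inl rfl⟩ ?_ ?_
    · rw [← e.prod_comp, Fin.prod_univ_two, log_map_mul (hd _) (hd _)]
      exact (hex _).add_odd (hex _)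
    · rw [← HasUnimodularLattice.diagonal_comp_equiv_iff e]
      exact hasUnimodularLattice_diagonal_fin_two hsurj hsq (fun k ↦ hd _) (fun k ↦ hex _)

lemma Matrix.IsSymm.exists_congr_diagonal (h2 : (2 : F) ≠ 0) {n : ℕ}
    {A : Matrix (Fin n) (Fin n) F} (hA : A.IsSymm) :
    ∃ (P : Matrix (Fin n) (Fin n) F) (d : Fin n → F), P.det ≠ 0 ∧ Pᵀ * A * P = diagonal d := by
  have : Invertible (2 : F) := invertibleOfNonzero h2
  have hB : LinearMap.IsSymm (toBilin' A) := by
    refine ⟨fun x y ↦ ?_⟩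
    simp only [toBilin'_apply', RingHom.id_apply]
    rw [dotProduct_comm, ← Matrix.vecMul_transpose, hA.eq, dotProduct_mulVec]
  obtain ⟨b, hb⟩ := LinearMap.BilinForm.exists_orthogonal_basis hB
  let c := b.reindex (finCongr (Module.finrank_fin_fun F))
  let b₀ := Pi.basisFun F (Fin n)
  refine ⟨b₀.toMatrix c, fun i ↦ toBilin' A (c i) (c i), ?_, ?_⟩
  · have := b₀.invertibleToMatrix c
    exact (isUnit_det_of_invertible (b₀.toMatrix c)).ne_zero
  · have hA' : LinearMap.BilinForm.toMatrix b₀ (toBilin' A) = A := by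
      ext i j
      simp [b₀, LinearMap.BilinForm.toMatrix_apply, toBilin'_single]
    have := LinearMap.BilinForm.toMatrix_mul_basis_toMatrix b₀ c (toBilin' A)
    rw [hA'] at this
    rw [this]
    ext i j
    rw [LinearMap.BilinForm.toMatrix_apply, diagonal_apply]
    split_ifs with hij
    · rw [hij]
    · rw [Module.Basis.reindex_apply, Module.Basis.reindex_apply]
      exact LinearMap.isOrthoᵢ_def.1 hb _ _ ((Equiv.injective _).ne hij)

theorem hasUnimodularLattice_iff_even_log (hsurj : Function.Surjective v)
    (hsq : ∀ t, v t = 1 → ∃ s, v (t + s ^ 2) < 1) (h2 : (2 : F) ≠ 0) {n : ℕ}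
    {A : Matrix (Fin n) (Fin n) F} (hA : A.IsSymm) (hdet : A.det ≠ 0) :
    HasUnimodularLattice v A ↔ Even (log (v A.det)) := by
  have key : ∀ P : Matrix (Fin n) (Fin n) F, P.det ≠ 0 →
      log (v (Pᵀ * A * P).det) = 2 * log (v P.det) + log (v A.det) := by
    intro P hP
    rw [map_det_transpose_mul_mul, log_mul (pow_ne_zero _ ((v.ne_zero_iff).2 hP))
      ((v.ne_zero_iff).2 hdet), log_pow]
    simp
  constructor
  · rintro ⟨P, hP, -, h1⟩
    have := key P hP
    rw [h1, log_one] at this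
    exact ⟨-log (v P.det), by linarith⟩
  · intro heven
    obtain ⟨P, d, hP, hd⟩ := hA.exists_congr_diagonal h2
    have hprod : (Pᵀ * A * P).det = ∏ i, d i := by rw [hd, det_diagonal]
    refine HasUnimodularLattice.of_congr P hP ?_
    rw [hd]
    refine hasUnimodularLattice_diagonal hsurj hsq ?_ ?_
    · have : ∏ i, d i ≠ 0 := by
        rw [← hprod, det_mul, det_mul, det_transpose]
        exact mul_ne_zero (mul_ne_zero hP hdet) hP
      exact fun i ↦ Finset.prod_ne_zero_iff.1 this i (Finset.mem_univ i)
    · rw [← hprod, key P hP]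
      exact (even_two_mul _).add heven

end UnimodularLattices

section DyadicCompletion

variable {K : Type*} [Field K] [NumberField K] (𝔭 : HeightOneSpectrum (𝓞 K))

lemma exists_algebraMap_sub_lt_one {t : 𝔭.adicCompletion K} (ht : Valued.v t ≤ 1) :
    ∃ r : 𝓞 K, Valued.v (t - algebraMap K (𝔭.adicCompletion K) (algebraMap (𝓞 K) K r)) < 1 := by
  obtain ⟨k, hk⟩ := (𝔭.denseRange_algebraMap K).mem_nhds (x := t)
    (s := {y | Valued.v (y - t) < 1}) (Valued.mem_nhds.2 ⟨1, fun y hy ↦ by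
      simpa [Valuation.restrict_lt_iff_lt_embedding] using hy⟩)
  have hk' : Valued.v (algebraMap K (𝔭.adicCompletion K) k - t) < 1 := hk
  have hk1 : 𝔭.valuation K k ≤ 1 := by
    rw [← 𝔭.valuedAdicCompletion_eq_valuation' k]
    have := Valued.v.map_add_le hk'.le ht
    rwa [sub_add_cancel] at this
  obtain ⟨r, hr⟩ := 𝔭.exists_valuation_sub_lt_of_integer hk1 1
  refine ⟨r, ?_⟩
  have hr' : Valued.v (algebraMap K (𝔭.adicCompletion K) (algebraMap (𝓞 K) K r - k)) < 1 :=
    (𝔭.valuedAdicCompletion_eq_valuation' _).trans_lt hr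
  rw [← Valuation.map_neg]
  convert Valued.v.map_add_lt hr' hk' using 2
  rw [map_sub]
  ring

lemma exists_add_sq_lt_one (h2 : (2 : 𝓞 K) ∈ 𝔭.asIdeal) (t : 𝔭.adicCompletion K)
    (ht : Valued.v t = 1) : ∃ s : 𝔭.adicCompletion K, Valued.v (t + s ^ 2) < 1 := by
  obtain ⟨r, hr⟩ := exists_algebraMap_sub_lt_one 𝔭 ht.le
  have : Finite (𝓞 K ⧸ 𝔭.asIdeal) := 𝔭.asIdeal.finiteQuotientOfFreeOfNeBot 𝔭.ne_bot
  have : 𝔭.asIdeal.IsMaximal := 𝔭.isMaximal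
  let := Ideal.Quotient.field 𝔭.asIdeal
  have hchar : ringChar (𝓞 K ⧸ 𝔭.asIdeal) = 2 :=
    CharP.ringChar_of_prime_eq_zero Nat.prime_two (Ideal.Quotient.eq_zero_iff_mem.2 h2)
  obtain ⟨c, hc⟩ := FiniteField.isSquare_of_char_two hchar (-Ideal.Quotient.mk 𝔭.asIdeal r)
  obtain ⟨s, rfl⟩ := Ideal.Quotient.mk_surjective c
  have hs : r + s ^ 2 ∈ 𝔭.asIdeal := by
    rw [← Ideal.Quotient.eq_zero_iff_mem, map_add, map_pow, pow_two, ← hc, add_neg_cancel]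
  refine ⟨algebraMap K (𝔭.adicCompletion K) (algebraMap (𝓞 K) K s), ?_⟩
  have hrs : Valued.v (algebraMap K (𝔭.adicCompletion K) (algebraMap (𝓞 K) K (r + s ^ 2))) < 1 :=
    (𝔭.valuedAdicCompletion_eq_valuation' _).trans_lt ((𝔭.valuation_lt_one_iff_mem _).2 hs)
  convert Valued.v.map_add_lt hr hrs using 2
  simp only [map_add, map_pow]
  ring

end DyadicCompletion

theorem stmt11 (K : Type) [Field K] [NumberField K] (htr : TotallyReal K)
    (𝔭 : HeightOneSpectrum (𝓞 K)) (hdyadic : (2 : 𝓞 K) ∈ 𝔭.asIdeal)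
    (n : ℕ) (A : Matrix (Fin n) (Fin n) (𝔭.adicCompletion K))
    (hsymm : A.IsSymm) (hdet : A.det ≠ 0) :
    (∃ k : ℤ, Valued.v A.det =
        ((Multiplicative.ofAdd (2 * k) : Multiplicative ℤ) : WithZero (Multiplicative ℤ)))
      ↔
    ∃ P : Matrix (Fin n) (Fin n) (𝔭.adicCompletion K), IsUnit P.det ∧
      (∀ i j, (Pᵀ * A * P) i j ∈ 𝔭.adicCompletionIntegers K) ∧
      ∃ u : (↥(𝔭.adicCompletionIntegers K))ˣ,
        ((u : ↥(𝔭.adicCompletionIntegers K)) : 𝔭.adicCompletion K) = (Pᵀ * A * P).det := by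
  have h2 : (2 : 𝔭.adicCompletion K) ≠ 0 := by
    rw [← map_ofNat (algebraMap K (𝔭.adicCompletion K)) 2]
    exact (map_ne_zero _).2 two_ne_zero
  have h := hasUnimodularLattice_iff_even_log (v := (Valued.v : Valuation (𝔭.adicCompletion K) _))
    (𝔭.valuedAdicCompletion_surjective K) (exists_add_sq_lt_one 𝔭 hdyadic) h2 hsymm hdet
  have hv : Valued.v A.det ≠ 0 := (Valuation.ne_zero_iff _).2 hdet
  trans Even (WithZero.log (Valued.v A.det))
  · constructor
    · rintro ⟨k, hk⟩
      rw [hk, ← WithZero.exp_eq_coe_ofAdd, WithZero.log_exp]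
      exact even_two_mul k
    · rintro ⟨k, hk⟩
      exact ⟨k, by rw [← WithZero.exp_eq_coe_ofAdd, two_mul, ← hk, WithZero.exp_log hv]⟩
  · rw [← h]
    refine exists_congr fun P ↦ and_congr isUnit_iff_ne_zero.symm (and_congr Iff.rfl ⟨?_, ?_⟩)
    · intro hP
      obtain ⟨u, hu⟩ := HeightOneSpectrum.adicCompletionIntegers.isUnit_iff_valued_eq_one.2
        (show Valued.v (⟨(Pᵀ * A * P).det, hP.le⟩ : 𝔭.adicCompletionIntegers K).1 = 1 from hP)
      exact ⟨u, by rw [hu]⟩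
    · rintro ⟨u, hu⟩
      rw [← hu]
      exact HeightOneSpectrum.adicCompletionIntegers.isUnit_iff_valued_eq_one.1 u.isUnit
end
end

section
/- Let K be a totally real number field, let 𝔭 be a dyadic maximal ideal of O_K, and let n ≥ 1. For every symmetric matrix G ∈ M_n(O_𝔭) with det G ≠ 0, there exist: a symmetric matrix U ∈ M_{n+3}(O_𝔭) with det U a unit of O_𝔭, an invertible matrix P ∈ GL_{n+3}(K_𝔭) with Pᵀ U P equal to the identity matrix I_{n+3}, and a matrix X ∈ M_{(n+3)×n}(O_𝔭) with Xᵀ U X = G. (That is, every nondegenerate O_𝔭-lattice of rank n is represented by a unimodular O_𝔭-lattice on the sum-of-squares space I_{n+3} ⊗ K_𝔭.) -/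
open NumberField IsDedekindDomain Matrix

noncomputable section

section

open WithZero

/-- A valued field with uniformizer `π` and dyadic perfect residue field for which the
Artin–Schreier polynomials `X ^ 2 + X + c` with small `c` have unit roots. -/
structure IsDyadicUniformizer {F : Type*} [Field F] (v : Valuation F ℤᵐ⁰) (π : F) : Prop where
  map_eq : v π = exp (-1 : ℤ)
  two_ne_zero : (2 : F) ≠ 0
  map_two_lt : v 2 < 1
  exists_sq : ∀ a, v a ≤ 1 → ∃ b, v b ≤ 1 ∧ v (a - b ^ 2) < 1
  exists_root : ∀ c, v c < 1 → ∃ u, v u = 1 ∧ u ^ 2 + u + c = 0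
  noetherian : IsNoetherianRing v.valuationSubring

section AdicCompletion

variable {K : Type*} [Field K] [NumberField K] (𝔭 : HeightOneSpectrum (𝓞 K))

theorem adicCompletion_exists_root {c : 𝔭.adicCompletion K} (hc : Valued.v c < 1) :
    ∃ u : 𝔭.adicCompletion K, Valued.v u = 1 ∧ u ^ 2 + u + c = 0 := by
  have hn : ‖c‖ < 1 := Valued.toNormedField.norm_lt_one_iff.2 hc
  have hu : ∀ x y : 𝔭.adicCompletion K, ‖x + y‖ ≤ max ‖x‖ ‖y‖ :=
    IsUltrametricDist.norm_add_le_max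
  let s : Set (𝔭.adicCompletion K) := Metric.closedBall 0 ‖c‖
  let f : 𝔭.adicCompletion K → 𝔭.adicCompletion K := fun w => w ^ 2 + c
  have hs : ∀ w, w ∈ s ↔ ‖w‖ ≤ ‖c‖ := fun w => by simp [s]
  have hsc : IsComplete s := Metric.isClosed_closedBall.isComplete
  have hmaps : Set.MapsTo f s s := by
    intro w hw
    rw [hs] at hw ⊢
    refine (hu _ _).trans (max_le ?_ le_rfl)
    rw [norm_pow, sq]
    nlinarith [norm_nonneg w]
  have hcontr : ContractingWith ‖c‖₊ (hmaps.restrict f s s) := by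
    refine ⟨hn, LipschitzWith.of_dist_le_mul ?_⟩
    rintro ⟨x, hx⟩ ⟨y, hy⟩
    rw [hs] at hx hy
    simp only [Subtype.dist_eq, Set.MapsTo.val_restrict_apply, dist_eq_norm, f]
    have : x ^ 2 + c - (y ^ 2 + c) = (x + y) * (x - y) := by ring
    rw [this, norm_mul]
    exact mul_le_mul_of_nonneg_right ((hu _ _).trans (max_le hx hy)) (norm_nonneg _)
  obtain ⟨w, hw, hfix, -⟩ := hcontr.exists_fixedPoint' hsc hmaps
    (show c ∈ s from (hs c).2 le_rfl) (edist_ne_top _ _)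
  have hw1 : Valued.v w < 1 := Valued.toNormedField.norm_lt_one_iff.1 (((hs w).1 hw).trans_lt hn)
  refine ⟨w - 1, ?_, ?_⟩
  · rw [Valuation.map_sub_swap, Valuation.map_one_sub_of_lt _ hw1]
  · have : w ^ 2 + c = w := hfix
    linear_combination this

theorem adicCompletion_exists_sq (h2 : (2 : 𝓞 K) ∈ 𝔭.asIdeal) {a : 𝔭.adicCompletion K}
    (ha : Valued.v a ≤ 1) :
    ∃ b : 𝔭.adicCompletion K, Valued.v b ≤ 1 ∧ Valued.v (a - b ^ 2) < 1 := by
  have hclose : ∃ k : K, Valued.v (a - (k : 𝔭.adicCompletion K)) < 1 := by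
    have hd := HeightOneSpectrum.denseRange_algebraMap K 𝔭
    have ho : IsOpen {x : 𝔭.adicCompletion K | Valued.v (a - x) < 1} := by
      have : IsOpen {x : 𝔭.adicCompletion K | ‖a - x‖ < 1} :=
        isOpen_lt (by fun_prop) continuous_const
      simpa only [Valued.toNormedField.norm_lt_one_iff] using this
    obtain ⟨k, hk⟩ := hd.exists_mem_open ho ⟨a, by simp⟩
    exact ⟨k, hk⟩
  obtain ⟨k, hk⟩ := hclose
  have hk1 : 𝔭.valuation K k ≤ 1 := by
    rw [← HeightOneSpectrum.valuedAdicCompletion_eq_valuation' 𝔭 k]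
    have : (k : 𝔭.adicCompletion K) = a - (a - k) := by ring
    rw [this]
    exact (Valuation.map_sub _ _ _).trans (max_le ha hk.le)
  obtain ⟨r, hr⟩ := 𝔭.exists_valuation_sub_lt_of_integer hk1 1
  have : 𝔭.asIdeal.IsMaximal := 𝔭.isMaximal
  let := Ideal.Quotient.field 𝔭.asIdeal
  have : Finite (𝓞 K ⧸ 𝔭.asIdeal) := 𝔭.asIdeal.finiteQuotientOfFreeOfNeBot 𝔭.ne_bot
  have : CharP (𝓞 K ⧸ 𝔭.asIdeal) 2 :=
    CharTwo.of_one_ne_zero_of_two_eq_zero one_ne_zero (Ideal.Quotient.eq_zero_iff_mem.2 h2)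
  obtain ⟨t, ht⟩ := surjective_frobenius (𝓞 K ⧸ 𝔭.asIdeal) 2 (Ideal.Quotient.mk _ r)
  obtain ⟨s, rfl⟩ := Ideal.Quotient.mk_surjective t
  have hs : 𝔭.valuation K (algebraMap (𝓞 K) K (r - s ^ 2)) < 1 := by
    rw [HeightOneSpectrum.valuation_lt_one_iff_mem, ← Ideal.Quotient.eq_zero_iff_mem]
    simp [← ht, frobenius_def]
  refine ⟨((algebraMap (𝓞 K) K s : K) : 𝔭.adicCompletion K), ?_, ?_⟩
  · rw [HeightOneSpectrum.valuedAdicCompletion_eq_valuation' 𝔭]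
    exact 𝔭.valuation_le_one s
  · have hks : Valued.v (((k - algebraMap (𝓞 K) K s ^ 2 : K)) : 𝔭.adicCompletion K) < 1 := by
      rw [HeightOneSpectrum.valuedAdicCompletion_eq_valuation' 𝔭]
      have : k - algebraMap (𝓞 K) K s ^ 2 =
        algebraMap (𝓞 K) K (r - s ^ 2) - (algebraMap (𝓞 K) K r - k) := by simp
      rw [this]
      exact (Valuation.map_sub _ _ _).trans_lt (max_lt hs (by simpa using hr))
    have : a - ((algebraMap (𝓞 K) K s : K) : 𝔭.adicCompletion K) ^ 2 =
        (a - k) + ((k - algebraMap (𝓞 K) K s ^ 2 : K) : 𝔭.adicCompletion K) := by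
      have e : ∀ x : K, (x : 𝔭.adicCompletion K) = algebraMap K _ x := fun _ => rfl
      rw [e, e, e, map_sub, map_pow]
      ring
    rw [this]
    exact (Valuation.map_add _ _ _).trans_lt (max_lt hk hks)

theorem adicCompletion_exists_uniformizer (h2 : (2 : 𝓞 K) ∈ 𝔭.asIdeal) :
    ∃ π : 𝔭.adicCompletion K, IsDyadicUniformizer Valued.v π := by
  obtain ⟨π, hπ⟩ := 𝔭.valuation_exists_uniformizer K
  have e : ((2 : K) : 𝔭.adicCompletion K) = 2 := map_ofNat (algebraMap K _) 2
  refine ⟨(π : 𝔭.adicCompletion K), ?_, ?_, ?_, fun a => adicCompletion_exists_sq 𝔭 h2,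
    fun c => adicCompletion_exists_root 𝔭,
    inferInstanceAs (IsNoetherianRing (𝔭.adicCompletionIntegers K))⟩
  · rw [HeightOneSpectrum.valuedAdicCompletion_eq_valuation' 𝔭, hπ]
  · rw [← e]
    exact (map_ne_zero (algebraMap K (𝔭.adicCompletion K))).2 two_ne_zero
  · rw [← e, HeightOneSpectrum.valuedAdicCompletion_eq_valuation' 𝔭]
    rw [← map_ofNat (algebraMap (𝓞 K) K) 2]
    exact (𝔭.valuation_lt_one_iff_mem (K := K) 2).2 h2

end AdicCompletion

/-- Over a perfect field of characteristic two every ternary quadratic form is isotropic. -/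
theorem exists_ternary_zero {k : Type*} [Field k] (h2 : (2 : k) = 0)
    (hsq : ∀ a : k, ∃ b, b ^ 2 = a) (p q r d e f : k) :
    ∃ x y z : k, (x ≠ 0 ∨ y ≠ 0 ∨ z ≠ 0) ∧
      p * x ^ 2 + q * y ^ 2 + r * z ^ 2 + d * x * y + e * x * z + f * y * z = 0 := by
  by_cases hp : p = 0
  · exact ⟨1, 0, 0, by simp, by simp [hp]⟩
  by_cases hde : d = 0 ∧ e = 0
  · obtain ⟨t, ht⟩ := hsq (-q / p)
    refine ⟨t, 1, 0, by simp, ?_⟩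
    rw [ht, hde.1]
    field_simp
    ring
  by_cases hR : p * f ^ 2 + q * e ^ 2 + r * d ^ 2 + d * f * e + e * f * d + f * e * d = 0
  · exact ⟨f, e, d, by tauto, hR⟩
  obtain ⟨t, ht⟩ := hsq
    (-p / (p * f ^ 2 + q * e ^ 2 + r * d ^ 2 + d * f * e + e * f * d + f * e * d))
  rw [eq_div_iff hR] at ht
  refine ⟨t * f + 1, t * e, t * d, ?_, ?_⟩
  · by_cases ht0 : t = 0
    · simp [ht0]
    · simp only [mul_ne_zero_iff]
      tauto
  · linear_combination ht + (p * t * f + t * d * e) * h2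

namespace IsDyadicUniformizer

variable {F : Type*} [Field F] {v : Valuation F ℤᵐ⁰} {π : F} (h : IsDyadicUniformizer v π)
include h

theorem ne_zero : π ≠ 0 := by
  rintro rfl
  exact exp_ne_zero (h.map_eq.symm.trans (map_zero v))

theorem lt_one_iff {x : F} : v x < 1 ↔ v x ≤ v π := by
  rw [h.map_eq]
  by_cases hx : v x = 0
  · simp [hx]
  rw [← exp_log hx, ← exp_zero, exp_lt_exp, exp_le_exp]
  lia

theorem lt_iff {x c : F} (hc : c ≠ 0) : v x < v c ↔ v x ≤ v (π * c) := by
  have hc' : 0 < v c := by simpa [zero_lt_iff] using hc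
  have := h.lt_one_iff (x := x / c)
  rwa [map_div₀, div_lt_one₀ hc', div_le_iff₀ hc', ← map_mul] at this

omit h in
theorem residue_eq_zero_iff (a : v.valuationSubring) :
    IsLocalRing.residue v.valuationSubring a = 0 ↔ v (a : F) < 1 := by
  rw [IsLocalRing.residue_eq_zero_iff, Valuation.mem_maximalIdeal_iff]

theorem residue_two : (2 : IsLocalRing.ResidueField v.valuationSubring) = 0 := by
  rw [← map_ofNat (IsLocalRing.residue v.valuationSubring) 2, residue_eq_zero_iff]
  exact h.map_two_lt

theorem residue_exists_sq (a : IsLocalRing.ResidueField v.valuationSubring) : ∃ b, b ^ 2 = a := by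
  obtain ⟨a, rfl⟩ := IsLocalRing.residue_surjective a
  obtain ⟨b, hb, hab⟩ := h.exists_sq a a.2
  refine ⟨IsLocalRing.residue _ ⟨b, hb⟩, ?_⟩
  rw [eq_comm, ← sub_eq_zero, ← map_pow, ← map_sub, residue_eq_zero_iff]
  exact hab

theorem exists_ternary {p q r d e f : F} (hp : v p ≤ 1) (hq : v q ≤ 1) (hr : v r ≤ 1)
    (hd : v d ≤ 1) (he : v e ≤ 1) (hf : v f ≤ 1) :
    ∃ x y z : F, v x ≤ 1 ∧ v y ≤ 1 ∧ v z ≤ 1 ∧ (v x = 1 ∨ v y = 1 ∨ v z = 1) ∧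
      v (p * x ^ 2 + q * y ^ 2 + r * z ^ 2 + d * x * y + e * x * z + f * y * z) < 1 := by
  let ρ := IsLocalRing.residue v.valuationSubring
  obtain ⟨x, y, z, hne, h0⟩ := exists_ternary_zero h.residue_two h.residue_exists_sq
    (ρ ⟨p, hp⟩) (ρ ⟨q, hq⟩) (ρ ⟨r, hr⟩) (ρ ⟨d, hd⟩) (ρ ⟨e, he⟩) (ρ ⟨f, hf⟩)
  obtain ⟨x, rfl⟩ := IsLocalRing.residue_surjective x
  obtain ⟨y, rfl⟩ := IsLocalRing.residue_surjective y
  obtain ⟨z, rfl⟩ := IsLocalRing.residue_surjective z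
  have key : ∀ a : v.valuationSubring, ρ a ≠ 0 → v (a : F) = 1 := fun a ha =>
    le_antisymm a.2 (not_lt.1 fun hlt => ha ((residue_eq_zero_iff a).2 hlt))
  refine ⟨x, y, z, x.2, y.2, z.2, hne.imp (key x) (Or.imp (key y) (key z)), ?_⟩
  simp only [ρ, ← map_pow, ← map_mul, ← map_add, residue_eq_zero_iff] at h0
  exact h0

variable {V : Type*} [AddCommGroup V] [Module F V] {B : LinearMap.BilinForm F V}

theorem map_two_mul_le (hB : B.IsSymm) (han : ∀ x, B x x = 0 → x = 0) {c : F} {x y : V}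
    (hx : v (B x x) ≤ v c) (hy : v (B y y) ≤ v c) : v (2 * B x y) ≤ v c := by
  by_contra! hlt
  set b := 2 * B x y with hb
  have hb0 : b ≠ 0 := by
    rintro h0
    simp [h0] at hlt
  have hvb : 0 < v b := by simpa [zero_lt_iff] using hb0
  have hsmall : v (B x x * B y y / b ^ 2) < 1 := by
    rw [map_div₀, map_mul, map_pow, div_lt_one₀ (pow_pos hvb 2), sq]
    exact mul_lt_mul'' (hx.trans_lt hlt) (hy.trans_lt hlt) zero_le zero_le
  obtain ⟨u, hu, hroot⟩ := h.exists_root _ hsmall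
  have hu0 : u ≠ 0 := by
    rintro rfl
    simp at hu
  have hz : (B y y / (b * u)) • x + y = 0 := by
    apply han
    simp only [map_add, map_smul, LinearMap.add_apply, LinearMap.smul_apply, smul_eq_mul]
    rw [hB.eq y x]
    have : B y y / (b * u) * (B y y / (b * u) * B x x + B x y) +
        (B y y / (b * u) * B x y + B y y) =
        B y y / u ^ 2 * (u ^ 2 + u * ((2 * B x y) / b) + B x x * B y y / b ^ 2) := by
      field_simp
      ring
    rw [this, ← hb, div_self hb0, mul_one, hroot, mul_zero]
  have hy' : y = -(B y y / (b * u)) • x := by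
    rw [neg_smul]
    exact (neg_eq_of_add_eq_zero_right hz).symm
  have hbx : b = -(2 * (B y y / (b * u)) * B x x) := by
    rw [hb]
    conv_lhs => rw [hy']
    simp only [map_smul, smul_eq_mul]
    ring
  have : v b < v b := by
    calc v b = v 2 * (v (B y y) / (v b * v u)) * v (B x x) := by
          conv_lhs => rw [hbx]
          simp only [Valuation.map_neg, map_mul, map_div₀]
      _ = v 2 * (v (B y y) / v b) * v (B x x) := by rw [hu, mul_one]
      _ ≤ 1 * 1 * v (B x x) := by
          gcongr
          · exact h.map_two_lt.le
          · rw [div_le_one₀ hvb]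
            exact (hy.trans_lt hlt).le
      _ < v b := by simpa using hx.trans_lt hlt
  exact this.false

theorem map_self_add_le (hB : B.IsSymm) (han : ∀ x, B x x = 0 → x = 0) {c : F} {x y : V}
    (hx : v (B x x) ≤ v c) (hy : v (B y y) ≤ v c) : v (B (x + y) (x + y)) ≤ v c := by
  have : B (x + y) (x + y) = B x x + 2 * B x y + B y y := by
    simp only [map_add, LinearMap.add_apply]
    rw [hB.eq y x]
    ring
  rw [this]
  exact v.map_add_le (v.map_add_le hx (h.map_two_mul_le hB han hx hy)) hy

theorem map_self_add_lt (hB : B.IsSymm) (han : ∀ x, B x x = 0 → x = 0) {c : F} (hc : c ≠ 0)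
    {x y : V} (hx : v (B x x) < v c) (hy : v (B y y) < v c) : v (B (x + y) (x + y)) < v c := by
  rw [h.lt_iff hc] at *
  exact h.map_self_add_le hB han hx hy

omit h in
theorem map_self_smul (a : F) (x : V) : v (B (a • x) (a • x)) = v a ^ 2 * v (B x x) := by
  simp only [map_smul, LinearMap.smul_apply, smul_eq_mul, map_mul, sq,
    mul_assoc]

theorem exists_small_combination (hB : B.IsSymm) (han : ∀ x, B x x = 0 → x = 0) {c : F}
    (hc : c ≠ 0) {x y z : V} (hx : v (B x x) ≤ v c) (hy : v (B y y) ≤ v c)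
    (hz : v (B z z) ≤ v c) :
    ∃ r s t : F, v r ≤ 1 ∧ v s ≤ 1 ∧ v t ≤ 1 ∧ (v r = 1 ∨ v s = 1 ∨ v t = 1) ∧
      v (B (r • x + s • y + t • z) (r • x + s • y + t • z)) < v c := by
  have hvc : 0 < v c := by simpa [zero_lt_iff] using hc
  have key : ∀ a, v a ≤ v c → v (a / c) ≤ 1 := fun a ha => by
    rwa [map_div₀, div_le_one₀ hvc]
  obtain ⟨r, s, t, hr, hs, ht, hu, hlt⟩ := h.exists_ternary (key _ hx) (key _ hy) (key _ hz)
    (key _ (h.map_two_mul_le hB han hx hy)) (key _ (h.map_two_mul_le hB han hx hz))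
    (key _ (h.map_two_mul_le hB han hy hz))
  refine ⟨r, s, t, hr, hs, ht, hu, ?_⟩
  rw [← div_lt_one₀ hvc, ← map_div₀]
  convert hlt using 2
  simp only [map_add, map_smul, LinearMap.add_apply, LinearMap.smul_apply, smul_eq_mul]
  rw [hB.eq y x, hB.eq z x, hB.eq z y]
  field_simp
  ring

theorem exists_two_generators (hB : B.IsSymm) (han : ∀ x, B x x = 0 → x = 0) {c : F}
    (hc : c ≠ 0) :
    ∃ y z : V, v (B y y) ≤ v c ∧ v (B z z) ≤ v c ∧ ∀ x, v (B x x) ≤ v c →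
      ∃ s t : F, v s ≤ 1 ∧ v t ≤ 1 ∧
        v (B (x - s • y - t • z) (x - s • y - t • z)) < v c := by
  have hvc : 0 < v c := by simpa [zero_lt_iff] using hc
  have small : ∀ (a : F) (x : V), v a ≤ 1 → ¬ v a = 1 → v (B x x) ≤ v c →
      v (B (-(a • x)) (-(a • x))) < v c := by
    intro a x ha ha1 hx
    rw [← neg_smul, map_self_smul, Valuation.map_neg]
    have ha' : v a < 1 := lt_of_le_of_ne ha ha1
    calc v a ^ 2 * v (B x x) ≤ v a ^ 2 * v c := by gcongr
      _ < 1 * v c := by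
        gcongr
        exact pow_lt_one₀ zero_le ha' (by norm_num)
      _ = v c := one_mul _
  have scale : ∀ (a : F) (x : V), v a = 1 → v (B (a • x) (a • x)) < v c → v (B x x) < v c := by
    intro a x ha hx
    rwa [map_self_smul, ha, one_pow, one_mul] at hx
  have vdiv : ∀ a b : F, v a ≤ 1 → v b = 1 → v (-(a / b)) ≤ 1 := by
    intro a b ha hb
    rwa [Valuation.map_neg, map_div₀, hb, div_one]
  have nz : ∀ b : F, v b = 1 → b ≠ 0 := by
    rintro b hb rfl
    simp at hb
  by_cases h1 : ∀ x, v (B x x) ≤ v c → v (B x x) < v c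
  · exact ⟨0, 0, by simp, by simp, fun x hx => ⟨0, 0, by simp, by simp, by simpa using h1 x hx⟩⟩
  push Not at h1
  obtain ⟨y, hy, hyc⟩ := h1
  by_cases h2 : ∀ x, v (B x x) ≤ v c → ∃ s : F, v s ≤ 1 ∧ v (B (x - s • y) (x - s • y)) < v c
  · refine ⟨y, 0, hy, by simp, fun x hx => ?_⟩
    obtain ⟨s, hs, hlt⟩ := h2 x hx
    exact ⟨s, 0, hs, by simp, by simpa using hlt⟩
  push Not at h2
  obtain ⟨z, hz, hzc⟩ := h2
  refine ⟨y, z, hy, hz, fun x hx => ?_⟩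
  obtain ⟨r, s, t, hr, hs, ht, hu, hlt⟩ := h.exists_small_combination hB han hc hx hy hz
  by_cases hr1 : v r = 1
  · refine ⟨-(s / r), -(t / r), vdiv s r hs hr1, vdiv t r ht hr1, scale r _ hr1 ?_⟩
    have : r • (x - -(s / r) • y - -(t / r) • z) = r • x + s • y + t • z := by
      have := nz r hr1
      match_scalars <;> field_simp
    rwa [this]
  exfalso
  have hlt2 : v (B (s • y + t • z) (s • y + t • z)) < v c := by
    have := h.map_self_add_lt hB han hc hlt (small r x hr hr1 hx)
    rwa [show r • x + s • y + t • z + -(r • x) = s • y + t • z by abel] at this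
  by_cases ht1 : v t = 1
  · refine (hzc (-(s / t)) (vdiv s t hs ht1)).not_gt (scale t _ ht1 ?_)
    have : t • (z - -(s / t) • y) = s • y + t • z := by
      have := nz t ht1
      match_scalars <;> field_simp
    rwa [this]
  have hlt3 := h.map_self_add_lt hB han hc hlt2 (small t z ht ht1 hz)
  rw [add_neg_cancel_right] at hlt3
  have hs1 : v s = 1 := by tauto
  exact hyc.not_gt (scale s y hs1 hlt3)

/-- In an anisotropic space the vectors of integral norm form a lattice. -/
def normLattice (hB : B.IsSymm) (han : ∀ x, B x x = 0 → x = 0) :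
    Submodule v.valuationSubring V where
  carrier := {x | v (B x x) ≤ 1}
  zero_mem' := by simp
  add_mem' {x y} hx hy := by
    have := h.map_self_add_le (c := 1) (x := x) (y := y) hB han
    simp only [map_one] at this
    exact this hx hy
  smul_mem' a x hx := by
    change v (B ((a : F) • x) ((a : F) • x)) ≤ 1
    rw [map_self_smul]
    exact mul_le_one' (pow_le_one₀ zero_le a.2) hx

omit h in
theorem exists_smul_map_self_le_one (x : V) :
    ∃ a : F, a ≠ 0 ∧ v (B (a • x) (a • x)) ≤ 1 := by
  by_cases hx : v (B x x) ≤ 1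
  · exact ⟨1, one_ne_zero, by simpa using hx⟩
  have hx0 : v (B x x) ≠ 0 := fun h0 => hx (by simp [h0])
  refine ⟨(B x x)⁻¹, inv_ne_zero ((v.ne_zero_iff).1 hx0), ?_⟩
  rw [map_self_smul, map_inv₀, sq, mul_assoc, inv_mul_cancel₀ hx0, mul_one]
  exact inv_le_one_of_one_le₀ (not_le.1 hx).le

theorem normLattice_fg [FiniteDimensional F V] (hB : B.IsSymm)
    (han : ∀ x, B x x = 0 → x = 0) : (h.normLattice hB han).FG := by
  have := h.noetherian
  let e := Module.finBasis F V
  choose a ha hae using fun i => exists_smul_map_self_le_one (v := v) (B := B) (e i)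
  have hint : ∀ i (x : h.normLattice hB han), v (2 * B (a i • e i) x) ≤ 1 := fun i x => by
    have := h.map_two_mul_le (c := 1) hB han (x := a i • e i) (y := (x : V))
    simp only [map_one] at this
    exact this (hae i) x.2
  let φ : h.normLattice hB han →ₗ[v.valuationSubring]
      (Fin (Module.finrank F V) → v.valuationSubring) :=
    { toFun := fun x i => ⟨2 * B (a i • e i) x, hint i x⟩
      map_add' := fun x y => by
        ext i
        simp [mul_add]
      map_smul' := fun c x => by
        ext i
        change 2 * B (a i • e i) ((c : F) • (x : V)) = (c : F) * (2 * B (a i • e i) x)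
        rw [map_smul, smul_eq_mul]
        ring }
  have hφ : Function.Injective φ := by
    rw [← LinearMap.ker_eq_bot, LinearMap.ker_eq_bot']
    intro x hx
    have hx' : ∀ i, B x (e i) = 0 := fun i => by
      have : 2 * B (a i • e i) x = 0 := congrArg Subtype.val (congrFun hx i)
      rw [hB.eq, map_smul, smul_eq_mul] at this
      simpa [h.two_ne_zero, ha i] using this
    have : B x = 0 := e.ext (by simpa using hx')
    exact Subtype.ext (han x (by rw [this]; rfl))
  have := Module.Finite.of_injective φ hφ
  exact Module.Finite.iff_fg.1 this

theorem exists_isotropic (hB : B.IsSymm) (hV : 5 ≤ Module.finrank F V) :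
    ∃ x, x ≠ 0 ∧ B x x = 0 := by
  by_contra! hne
  have han : ∀ x, B x x = 0 → x = 0 := fun x hx => by
    by_contra hx0
    exact hne x hx0 hx
  have : FiniteDimensional F V := Module.finite_of_finrank_pos (by lia)
  set M := h.normLattice hB han with hM
  have memM : ∀ x, x ∈ M ↔ v (B x x) ≤ 1 := fun x => Iff.rfl
  obtain ⟨y₁, y₂, hy₁, hy₂, hy⟩ := h.exists_two_generators hB han one_ne_zero
  obtain ⟨z₁, z₂, hz₁, hz₂, hz⟩ := h.exists_two_generators hB han h.ne_zero
  let N : Submodule v.valuationSubring V := Submodule.span _ {y₁, y₂, z₁, z₂}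
  have hMN : M ≤ N := by
    refine Submodule.le_of_le_smul_of_le_jacobson_bot (h.normLattice_fg hB han)
      (IsLocalRing.maximalIdeal_le_jacobson _) fun x hx => ?_
    obtain ⟨s, t, hs, ht, hst⟩ := hy x (by rwa [map_one, ← memM])
    rw [h.lt_iff one_ne_zero, mul_one] at hst
    obtain ⟨s', t', hs', ht', hst'⟩ := hz _ hst
    rw [h.lt_iff h.ne_zero] at hst'
    set w := x - s • y₁ - t • y₂ - s' • z₁ - t' • z₂ with hw
    have hwM : π⁻¹ • w ∈ M := by
      have h0 : v π ≠ 0 := (v.ne_zero_iff).2 h.ne_zero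
      rw [memM, map_self_smul, map_inv₀]
      calc (v π)⁻¹ ^ 2 * v (B w w) ≤ (v π)⁻¹ ^ 2 * v (π * π) := by gcongr
        _ = 1 := by rw [map_mul, ← sq, inv_pow, inv_mul_cancel₀ (pow_ne_zero 2 h0)]
    have hπ : v π < 1 := h.lt_one_iff.2 le_rfl
    have hwm : w ∈ IsLocalRing.maximalIdeal v.valuationSubring • M := by
      have : w = (⟨π, hπ.le⟩ : v.valuationSubring) • (π⁻¹ • w) :=
        (smul_inv_smul₀ h.ne_zero w).symm
      rw [this]
      exact Submodule.smul_mem_smul ((Valuation.mem_maximalIdeal_iff F v).2 hπ) hwM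
    have hxw : x = (s • y₁ + t • y₂ + s' • z₁ + t' • z₂) + w := by
      rw [hw]
      abel
    rw [hxw]
    have mem : ∀ (a : F) (ha : v a ≤ 1) (u : V), u ∈ ({y₁, y₂, z₁, z₂} : Set V) → a • u ∈ N :=
      fun a ha u hu => N.smul_mem (⟨a, ha⟩ : v.valuationSubring) (Submodule.subset_span hu)
    refine Submodule.add_mem_sup (N.add_mem (N.add_mem (N.add_mem ?_ ?_) ?_) ?_) hwm
    · exact mem s hs _ (by simp)
    · exact mem t ht _ (by simp)
    · exact mem s' hs' _ (by simp)
    · exact mem t' ht' _ (by simp)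
  have hspan : Submodule.span F ({y₁, y₂, z₁, z₂} : Set V) = ⊤ := by
    refine eq_top_iff.2 fun x _ => ?_
    obtain ⟨a, ha, hax⟩ := exists_smul_map_self_le_one (v := v) (B := B) x
    have := Submodule.span_le_restrictScalars v.valuationSubring F _ (hMN hax)
    rwa [Submodule.restrictScalars_mem, Submodule.smul_mem_iff _ ha] at this
  classical
  have hcard : (({y₁, y₂, z₁, z₂} : Finset V)).card ≤ 4 := Finset.card_le_four
  have := finrank_span_finset_le_card (R := F) ({y₁, y₂, z₁, z₂} : Finset V)
  have hcoe : (({y₁, y₂, z₁, z₂} : Finset V) : Set V) = {y₁, y₂, z₁, z₂} := by simp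
  rw [Set.finrank, hcoe, hspan, finrank_top] at this
  lia

/-- Nondegenerate forms in at least four variables are universal. -/
theorem exists_self_eq (hB : B.IsSymm) (hnd : B.Nondegenerate)
    (hV : 4 ≤ Module.finrank F V) (d : F) : ∃ x, B x x = d := by
  have : FiniteDimensional F V := Module.finite_of_finrank_pos (by lia)
  let B' : LinearMap.BilinForm F (V × F) :=
    B.compl₁₂ (LinearMap.fst F V F) (LinearMap.fst F V F) -
      d • (LinearMap.mul F F).compl₁₂ (LinearMap.snd F V F) (LinearMap.snd F V F)
  have hB'a : ∀ p q, B' p q = B p.1 q.1 - d * (p.2 * q.2) := fun p q => rfl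
  have hB' : B'.IsSymm := ⟨fun p q => by
    rw [hB'a, hB'a, hB.eq, mul_comm p.2]⟩
  obtain ⟨⟨x, t⟩, hne, h0⟩ := h.exists_isotropic hB' (by
    rw [Module.finrank_prod, Module.finrank_self]
    lia)
  rw [hB'a, sub_eq_zero] at h0
  by_cases ht : t = 0
  · subst ht
    have hx : x ≠ 0 := by
      rintro rfl
      exact hne rfl
    obtain ⟨w, hw⟩ : ∃ w, B x w ≠ 0 := by
      by_contra! hall
      exact hx (hnd.1 x hall)
    have h2 := h.two_ne_zero
    simp only [mul_zero] at h0
    refine ⟨w + ((d - B w w) / (2 * B x w)) • x, ?_⟩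
    simp only [map_add, map_smul, LinearMap.add_apply, LinearMap.smul_apply, smul_eq_mul]
    rw [h0, hB.eq w x]
    field_simp
    ring
  · refine ⟨t⁻¹ • x, ?_⟩
    simp only [map_smul, LinearMap.smul_apply, smul_eq_mul]
    simp only at h0
    rw [h0]
    field_simp

/-- A nondegenerate space of dimension `n + 3` has an orthogonal basis whose first `n` norms
are prescribed. -/
theorem exists_orthogonal_family (n : ℕ) (hB : B.IsSymm) (hnd : B.Nondegenerate)
    (hV : Module.finrank F V = n + 3) (d : Fin n → F) (hd : ∀ i, d i ≠ 0) :
    ∃ (e : Fin 3 → F) (w : Fin n ⊕ Fin 3 → V), (∀ i, e i ≠ 0) ∧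
      ∀ i j, B (w i) (w j) = if i = j then Sum.elim d e i else 0 := by
  have : FiniteDimensional F V := Module.finite_of_finrank_pos (by lia)
  induction n generalizing V with
  | zero =>
    have : Invertible (2 : F) := invertibleOfNonzero h.two_ne_zero
    obtain ⟨b, hb⟩ := LinearMap.BilinForm.exists_orthogonal_basis (B := B) ⟨hB.eq⟩
    let b' := b.reindex (finCongr (hV.trans (zero_add 3)))
    have hb' : B.IsOrthoᵢ b' := fun i j hij => by
      simpa [b', Function.onFun] using hb (by simpa using hij)
    refine ⟨fun i => B (b' i) (b' i), fun i => b' (i.elim Fin.elim0 id), fun i => ?_, ?_⟩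
    · exact LinearMap.IsOrthoᵢ.not_isOrtho_basis_self_of_separatingLeft hb' hnd.1 i
    · rintro (i | i) (j | j)
      · exact i.elim0
      · exact i.elim0
      · exact j.elim0
      · by_cases hij : i = j
        · simp [hij]
        · simpa [hij] using hb' hij
  | succ n ih =>
    obtain ⟨x, hx⟩ := h.exists_self_eq hB hnd (by lia) (d 0)
    have hx0 : B x x ≠ 0 := hx ▸ hd 0
    let W := B.orthogonal (F ∙ x)
    have hW : Module.finrank F W = n + 3 := by
      have := Submodule.finrank_add_eq_of_isCompl
        (LinearMap.BilinForm.isCompl_span_singleton_orthogonal hx0)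
      rw [finrank_span_singleton (fun h0 => hx0 (by simp [h0]))] at this
      change _ + Module.finrank F W = _ at this
      lia
    obtain ⟨e, w, he, hw⟩ := ih (V := W) (B := B.restrict W)
      ⟨fun y z => hB.eq y z⟩
      (B.restrict_nondegenerate_orthogonal_spanSingleton hnd hB.isRefl hx0) hW
      (fun i => d i.succ) (fun i => hd _) inferInstance
    have hxw : ∀ i, B x (w i) = 0 := fun i =>
      (w i).2 x (Submodule.mem_span_singleton_self x)
    have hwx : ∀ i, B (w i) x = 0 := fun i => (hB.eq _ _).trans (hxw i)
    have hw' : ∀ i j, B (w i) (w j) = if i = j then Sum.elim (fun i => d i.succ) e i else 0 := hw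
    refine ⟨e, Sum.elim (Fin.cons x fun i => (w (Sum.inl i) : V)) fun i => w (Sum.inr i), he, ?_⟩
    rintro (i | i) (j | j)
    · refine Fin.cases ?_ (fun i => ?_) i <;> refine Fin.cases ?_ (fun j => ?_) j
      · simp [hx]
      · simpa [(Fin.succ_ne_zero j).symm] using hxw _
      · simpa using hwx _
      · simpa using hw' (Sum.inl i) (Sum.inl j)
    · refine Fin.cases ?_ (fun i => ?_) i
      · simpa using hxw _
      · simpa using hw' (Sum.inl i) (Sum.inr j)
    · refine Fin.cases ?_ (fun j => ?_) j
      · simpa using hwx _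
      · simpa using hw' (Sum.inr i) (Sum.inl j)
    · simpa using hw' (Sum.inr i) (Sum.inr j)

end IsDyadicUniformizer

section Matrix

variable {ι : Type*} [Fintype ι] [DecidableEq ι]

theorem Matrix.updateCol_mulVec_eq {R : Type*} [CommRing R] (A : Matrix ι ι R) (j : ι)
    (u z : ι → R) : A.updateCol j u *ᵥ z = A *ᵥ Function.update z j 0 + z j • u := by
  ext i
  have hj : z j * u i = ∑ k, if k = j then z j * u i else 0 := by simp
  simp only [mulVec, dotProduct, Pi.add_apply, Pi.smul_apply, smul_eq_mul]
  rw [hj, ← Finset.sum_add_distrib]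
  refine Finset.sum_congr rfl fun k _ => ?_
  by_cases hk : k = j
  · subst hk
    simp [mul_comm]
  · simp [hk]

theorem Matrix.exists_two_mulVec_eq_zero {k : Type*} [Field k] {A : Matrix ι ι k}
    (hdet : A.det = 0) (hadj : A.adjugate = 0) :
    ∃ y z : ι → k, y ≠ 0 ∧ (∀ c : k, c • y + z ≠ 0) ∧ A *ᵥ y = 0 ∧ A *ᵥ z = 0 := by
  obtain ⟨x, hx0, hx⟩ := exists_mulVec_eq_zero_iff.2 hdet
  by_contra! hne
  have hmul : ∀ z, A *ᵥ z = 0 → ∃ c : k, z = c • x := fun z hz => by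
    by_contra! hall
    refine hne x z hx0 (fun c hc => hall (-c) ?_) hx hz
    rw [neg_smul]
    exact (neg_eq_of_add_eq_zero_right hc).symm
  obtain ⟨j, hj⟩ := Function.ne_iff.1 hx0
  have hns : ¬ Function.Surjective A.mulVec := by
    rw [mulVec_surjective_iff_isUnit, isUnit_iff_isUnit_det, hdet]
    exact not_isUnit_zero
  obtain ⟨u, hu⟩ : ∃ u, ∀ z, A *ᵥ z ≠ u := by
    simpa [Function.Surjective] using hns
  have hdu : (A.updateCol j u).det = 0 := by
    rw [← cramer_apply, cramer_eq_adjugate_mulVec, hadj, zero_mulVec, Pi.zero_apply]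
  obtain ⟨z, hz0, hz⟩ := exists_mulVec_eq_zero_iff.2 hdu
  rw [updateCol_mulVec_eq] at hz
  have hzj : z j = 0 := by
    by_contra hzj
    refine hu (-(z j)⁻¹ • Function.update z j 0) ?_
    rw [mulVec_smul, eq_neg_of_add_eq_zero_left hz, neg_smul, smul_neg, neg_neg,
      inv_smul_smul₀ hzj]
  rw [hzj, zero_smul, add_zero, ← hzj, Function.update_eq_self] at hz
  obtain ⟨c, rfl⟩ := hmul z hz
  have hc : c = 0 := (mul_eq_zero.1 hzj).resolve_right hj
  exact hz0 (by simp [hc])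

omit [DecidableEq ι] in
theorem Matrix.IsSymm.dotProduct_mulVec_comm {R : Type*} [CommRing R] {A : Matrix ι ι R}
    (hA : A.IsSymm) (x y : ι → R) : x ⬝ᵥ A *ᵥ y = y ⬝ᵥ A *ᵥ x := by
  rw [dotProduct_comm, ← vecMul_transpose, hA.eq, ← dotProduct_mulVec]

theorem Matrix.exists_diagonalization {F : Type*} [Field F] (h2 : (2 : F) ≠ 0) {n : ℕ}
    {G : Matrix (Fin n) (Fin n) F} (hG : G.IsSymm) (hdet : G.det ≠ 0) :
    ∃ (R : Matrix (Fin n) (Fin n) F) (d : Fin n → F),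
      (∀ i, d i ≠ 0) ∧ Rᵀ * diagonal d * R = G := by
  have : Invertible (2 : F) := invertibleOfNonzero h2
  obtain ⟨b, hb⟩ := LinearMap.BilinForm.exists_orthogonal_basis (B := toBilin' G)
    ⟨fun x y => by
      simpa only [toBilin'_apply', RingHom.id_apply] using hG.dotProduct_mulVec_comm x y⟩
  let b' := b.reindex (finCongr (Module.finrank_fin_fun F))
  have hb' : ∀ i j, i ≠ j → b' i ⬝ᵥ G *ᵥ b' j = 0 := fun i j hij => by
    rw [← toBilin'_apply']
    simpa [b', Function.onFun] using hb (by simpa using hij)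
  let P : Matrix (Fin n) (Fin n) F := (Pi.basisFun F (Fin n)).toMatrix b'
  have hP : IsUnit P.det := by
    have := (Pi.basisFun F (Fin n)).invertibleToMatrix b'
    exact isUnit_det_of_invertible P
  have hPG : Pᵀ * G * P = diagonal fun i => b' i ⬝ᵥ G *ᵥ b' i := by
    ext i j
    have : (Pᵀ * G * P) i j = b' i ⬝ᵥ G *ᵥ b' j := by
      rw [Matrix.mul_assoc]
      rfl
    rw [this, diagonal_apply]
    split_ifs with hij
    · rw [hij]
    · exact hb' i j hij
  refine ⟨P⁻¹, fun i => b' i ⬝ᵥ G *ᵥ b' i, fun i hi => ?_, ?_⟩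
  · have hd : (Pᵀ * G * P).det ≠ 0 := by
      rw [det_mul, det_mul, det_transpose]
      exact mul_ne_zero (mul_ne_zero hP.ne_zero hdet) hP.ne_zero
    rw [hPG, det_diagonal] at hd
    exact hd (Finset.prod_eq_zero (Finset.mem_univ i) hi)
  · rw [← hPG, transpose_nonsing_inv]
    simp only [Matrix.mul_assoc]
    rw [mul_nonsing_inv _ hP, Matrix.mul_one, ← Matrix.mul_assoc,
      nonsing_inv_mul _ (by rwa [det_transpose]), Matrix.one_mul]

end Matrix

namespace IsDyadicUniformizer

variable {F : Type*} [Field F] {v : Valuation F ℤᵐ⁰} {π : F} (h : IsDyadicUniformizer v π)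
variable {ι : Type*} [Fintype ι]

theorem _root_.Valuation.map_dotProduct_le_one {x y : ι → F} (hx : ∀ i, v (x i) ≤ 1)
    (hy : ∀ i, v (y i) ≤ 1) : v (x ⬝ᵥ y) ≤ 1 :=
  v.map_sum_le fun i _ => by
    rw [map_mul]
    exact mul_le_one' (hx i) (hy i)

theorem _root_.Valuation.map_dotProduct_lt_one {x y : ι → F} (hx : ∀ i, v (x i) ≤ 1)
    (hy : ∀ i, v (y i) < 1) : v (x ⬝ᵥ y) < 1 :=
  v.map_sum_lt one_ne_zero fun i _ => by
    rw [map_mul]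
    exact (mul_le_of_le_one_left' (hx i)).trans_lt (hy i)

include h

variable [DecidableEq ι]

omit h in
theorem residue_ne_zero_iff (a : v.valuationSubring) :
    IsLocalRing.residue v.valuationSubring a ≠ 0 ↔ v (a : F) = 1 := by
  rw [ne_eq, residue_eq_zero_iff, not_lt]
  exact ⟨fun ha => le_antisymm a.2 ha, fun ha => ha.ge⟩

theorem exists_enlarging_vector {A : Matrix ι ι F} (hA : A.IsSymm) (hint : ∀ i j, v (A i j) ≤ 1)
    (hdet : v A.det ≤ v (π * π)) :
    ∃ (x : ι → F) (j : ι), (∀ i, v (x i) ≤ 1) ∧ v (x j) = 1 ∧ (∀ i, v ((A *ᵥ x) i) < 1) ∧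
      v (x ⬝ᵥ A *ᵥ x) ≤ v (π * π) := by
  have hπ : v π < 1 := h.lt_one_iff.2 le_rfl
  have hππ : v (π * π) < v π := (h.lt_iff h.ne_zero).2 le_rfl
  let O := v.valuationSubring
  let ρ := IsLocalRing.residue O
  let A₀ : Matrix ι ι O := Matrix.of fun i j => ⟨A i j, hint i j⟩
  have hA₀ : A₀.map O.subtype = A := rfl
  have hadj : A₀.adjugate.map O.subtype = A.adjugate := by
    rw [← hA₀]
    exact RingHom.map_adjugate O.subtype A₀
  by_cases hρ : (A₀.map ρ).adjugate = 0
  · have hdet₀ : (A₀.map ρ).det = 0 := by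
      have hd : O.subtype A₀.det = A.det := O.subtype.map_det A₀
      have : ρ A₀.det = (A₀.map ρ).det := ρ.map_det A₀
      rw [← this, residue_eq_zero_iff]
      change v (O.subtype A₀.det) < 1
      rw [hd]
      exact hdet.trans_lt (hππ.trans hπ)
    obtain ⟨y, z, hy0, hyz, hy, hz⟩ := exists_two_mulVec_eq_zero hdet₀ hρ
    choose Y hY using fun i => IsLocalRing.residue_surjective (y i)
    choose Z hZ using fun i => IsLocalRing.residue_surjective (z i)
    obtain rfl : (fun i => ρ (Y i)) = y := funext hY
    obtain rfl : (fun i => ρ (Z i)) = z := funext hZ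
    have hker : ∀ X : ι → O, (A₀.map ρ) *ᵥ (fun i => ρ (X i)) = 0 →
        ∀ i, v ((A *ᵥ fun i => (X i : F)) i) < 1 := fun X hX i => by
      have h1 : ρ ((A₀ *ᵥ X) i) = 0 := (ρ.map_mulVec A₀ X i).trans (congrFun hX i)
      rw [residue_eq_zero_iff] at h1
      have h2 : O.subtype ((A₀ *ᵥ X) i) = (A *ᵥ fun i => (X i : F)) i :=
        O.subtype.map_mulVec A₀ X i
      rwa [← h2]
    have hYk := hker Y hy
    have hZk := hker Z hz
    set Y' : ι → F := fun i => (Y i : F) with hY'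
    set Z' : ι → F := fun i => (Z i : F) with hZ'
    by_cases hα : v (Y' ⬝ᵥ A *ᵥ Y') ≤ v (π * π)
    · obtain ⟨j, hj⟩ := Function.ne_iff.1 hy0
      exact ⟨Y', j, fun i => (Y i).2, (residue_ne_zero_iff (Y j)).1 hj, hYk, hα⟩
    have hα' : v (Y' ⬝ᵥ A *ᵥ Y') = v π := by
      refine le_antisymm (h.lt_one_iff.1 (Valuation.map_dotProduct_lt_one (fun i => (Y i).2) hYk))
        (not_lt.1 ?_)
      rwa [h.lt_iff h.ne_zero]
    have hβ : v (Z' ⬝ᵥ A *ᵥ Z') ≤ v π :=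
      h.lt_one_iff.1 (Valuation.map_dotProduct_lt_one (fun i => (Z i).2) hZk)
    have hγ : v (Y' ⬝ᵥ A *ᵥ Z') ≤ v π :=
      h.lt_one_iff.1 (Valuation.map_dotProduct_lt_one (fun i => (Y i).2) hZk)
    set α := Y' ⬝ᵥ A *ᵥ Y'
    set β := Z' ⬝ᵥ A *ᵥ Z'
    set γ := Y' ⬝ᵥ A *ᵥ Z'
    have hvπ : 0 < v π := zero_lt_iff.2 ((v.ne_zero_iff).2 h.ne_zero)
    have hα0 : α ≠ 0 := by
      rw [← v.ne_zero_iff, hα']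
      exact hvπ.ne'
    obtain ⟨c, hc, hcs⟩ := h.exists_sq (-β / α) (by
      rwa [map_div₀, Valuation.map_neg, hα', div_le_one₀ hvπ])
    have hval : (c • Y' + Z') ⬝ᵥ A *ᵥ (c • Y' + Z') =
        -(α * (-β / α - c ^ 2)) + 2 * c * γ := by
      simp only [mulVec_add, mulVec_smul, dotProduct_add, add_dotProduct, smul_dotProduct,
        dotProduct_smul, smul_eq_mul]
      rw [hA.dotProduct_mulVec_comm Z' Y']
      change c * (c * α + γ) + (c * γ + β) = _
      field_simp
      ring
    obtain ⟨j, hj⟩ := Function.ne_iff.1 (hyz (ρ ⟨c, hc⟩))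
    have hj' : ρ (⟨c, hc⟩ * Y j + Z j) ≠ 0 := by
      rw [map_add, map_mul]
      exact hj
    refine ⟨c • Y' + Z', j, fun i => ((⟨c, hc⟩ : O) * Y i + Z i).2,
      (residue_ne_zero_iff _).1 hj', fun i => ?_, ?_⟩
    · rw [mulVec_add, mulVec_smul, Pi.add_apply, Pi.smul_apply, smul_eq_mul]
      refine v.map_add_lt ?_ (hZk i)
      rw [map_mul]
      exact (mul_le_of_le_one_left' hc).trans_lt (hYk i)
    · rw [hval]
      refine v.map_add_le ?_ ?_
      · rw [Valuation.map_neg, map_mul, map_mul, hα']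
        exact mul_le_mul_right (h.lt_one_iff.1 hcs) _
      · rw [map_mul, map_mul, map_mul]
        refine mul_le_mul' ?_ hγ
        calc v 2 * v c ≤ v π * 1 := mul_le_mul' (h.lt_one_iff.1 h.map_two_lt) hc
          _ = v π := mul_one _
  · obtain ⟨j, k, hjk⟩ : ∃ j k, (A₀.map ρ).adjugate j k ≠ 0 := by
      by_contra! hall
      exact hρ (Matrix.ext hall)
    have hm : (A₀.map ρ).adjugate j k = ρ (A₀.adjugate j k) :=
      congrFun (congrFun (RingHom.map_adjugate ρ A₀).symm j) k
    rw [hm] at hjk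
    let x : ι → F := fun i => A.adjugate i k
    have hx : ∀ i, x i = (A₀.adjugate i k : F) := fun i =>
      (congrFun (congrFun hadj i) k).symm
    have hxi : ∀ i, v (x i) ≤ 1 := fun i => by
      rw [hx]
      exact (A₀.adjugate i k).2
    have hAx : A *ᵥ x = A.det • Pi.single k 1 := by
      ext i
      have : (A * A.adjugate) i k = (A.det • (1 : Matrix ι ι F)) i k := by rw [mul_adjugate]
      refine this.trans ?_
      simp [Matrix.one_apply, Pi.single_apply]
    refine ⟨x, j, hxi, by rw [hx]; exact (residue_ne_zero_iff _).1 hjk, fun i => ?_, ?_⟩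
    · rw [hAx, Pi.smul_apply, smul_eq_mul, map_mul]
      refine (mul_le_of_le_one_right' ?_).trans_lt (hdet.trans_lt (hππ.trans hπ))
      rw [Pi.single_apply]
      split_ifs <;> simp
    · rw [hAx, dotProduct_smul, dotProduct_single, mul_one, smul_eq_mul, map_mul]
      exact (mul_le_mul' hdet (hxi k)).trans_eq (mul_one _)

theorem exists_enlargement {A : Matrix ι ι F} (hA : A.IsSymm) (hint : ∀ i j, v (A i j) ≤ 1)
    (hdet : v A.det ≤ v (π * π)) :
    ∃ (R A' : Matrix ι ι F) (t : F), (∀ i j, v (R i j) ≤ 1) ∧ A'.IsSymm ∧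
      (∀ i j, v (A' i j) ≤ 1) ∧ Rᵀ * A' * R = A ∧ A'.det = A.det * t ^ 2 ∧ v t * v π = 1 := by
  obtain ⟨x, j, hx, hxj, hAx, hxx⟩ := h.exists_enlarging_vector hA hint hdet
  have hπ0 := h.ne_zero
  have hvπ : v π ≠ 0 := (v.ne_zero_iff).2 hπ0
  have hπ : v π < 1 := h.lt_one_iff.2 le_rfl
  have hxj0 : x j ≠ 0 := by
    rintro h0
    simp [h0] at hxj
  let y : ι → F := π⁻¹ • x
  let r : ι → F := fun i => if i = j then π / x j else -x i / x j
  let T : Matrix ι ι F := (1 : Matrix ι ι F).updateCol j y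
  let R : Matrix ι ι F := (1 : Matrix ι ι F).updateCol j r
  have hTr : T *ᵥ r = Pi.single j 1 := by
    ext i
    rw [updateCol_mulVec_eq, one_mulVec]
    by_cases hi : i = j
    · subst hi
      simp [r, y]
      field_simp
    · simp [r, y, hi]
      field_simp
      ring
  have hTR : T * R = 1 := by
    ext a b
    by_cases hb : b = j
    · subst hb
      have : (T * R) a b = (T *ᵥ r) a := by
        simp [Matrix.mul_apply, mulVec, dotProduct, R]
      rw [this, hTr, Matrix.one_apply, Pi.single_apply]
    · have : (T * R) a b = T a b := by
        simp [Matrix.mul_apply, R, hb, Matrix.one_apply]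
      rw [this]
      simp [T, hb]
  have hTdet : T.det = π⁻¹ * x j := by
    change ((1 : Matrix ι ι F).updateCol j y).det = _
    rw [← cramer_apply, cramer_one]
    rfl
  have hcol : ∀ b, (fun a => T a b) = if b = j then y else Pi.single b 1 := fun b => by
    ext a
    by_cases hb : b = j
    · simp [T, hb]
    · simp [T, hb, Matrix.one_apply, Pi.single_apply]
  have hent : ∀ a b, (Tᵀ * A * T) a b = (fun i => T i a) ⬝ᵥ A *ᵥ fun i => T i b := fun a b => by
    rw [Matrix.mul_assoc]
    rfl
  have hAy : ∀ i, v ((A *ᵥ y) i) ≤ 1 := fun i => by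
    rw [mulVec_smul, Pi.smul_apply, smul_eq_mul, map_mul, map_inv₀]
    calc (v π)⁻¹ * v ((A *ᵥ x) i) ≤ (v π)⁻¹ * v π := by
          gcongr
          exact h.lt_one_iff.1 (hAx i)
      _ = 1 := inv_mul_cancel₀ hvπ
  have hyy : v (y ⬝ᵥ A *ᵥ y) ≤ 1 := by
    rw [mulVec_smul, dotProduct_smul, smul_dotProduct, smul_eq_mul, smul_eq_mul, ← mul_assoc,
      map_mul, map_mul, map_inv₀]
    calc (v π)⁻¹ * (v π)⁻¹ * v (x ⬝ᵥ A *ᵥ x) ≤ (v π)⁻¹ * (v π)⁻¹ * v (π * π) := by gcongr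
      _ = 1 := by rw [← mul_inv, map_mul, inv_mul_cancel₀ (mul_ne_zero hvπ hvπ)]
  refine ⟨R, Tᵀ * A * T, π⁻¹ * x j, fun a b => ?_, ?_, fun a b => ?_, ?_, ?_, ?_⟩
  · by_cases hb : b = j
    · subst hb
      by_cases ha : a = b
      · simp [R, r, ha, hxj, hπ.le]
      · simpa [R, r, ha, hxj] using hx a
    · simp only [R, updateCol_ne hb, Matrix.one_apply]
      split_ifs <;> simp
  · rw [IsSymm, transpose_mul, transpose_mul, transpose_transpose, hA.eq, Matrix.mul_assoc]
  · rw [hent, hcol, hcol]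
    split_ifs
    · exact hyy
    · rw [hA.dotProduct_mulVec_comm, single_dotProduct, one_mul]
      exact hAy b
    · rw [single_dotProduct, one_mul]
      exact hAy a
    · rw [single_dotProduct, one_mul, mulVec_single, MulOpposite.op_one, one_smul]
      exact hint a b
  · calc Rᵀ * (Tᵀ * A * T) * R = (T * R)ᵀ * A * (T * R) := by
          rw [transpose_mul]
          simp only [Matrix.mul_assoc]
      _ = A := by rw [hTR, transpose_one, Matrix.one_mul, Matrix.mul_one]
  · rw [det_mul, det_mul, det_transpose, hTdet]
    ring
  · rw [map_mul, hxj, mul_one, map_inv₀, inv_mul_cancel₀ hvπ]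

theorem exists_unimodular {A : Matrix ι ι F} (hA : A.IsSymm) (hint : ∀ i j, v (A i j) ≤ 1)
    {s : F} (hs : s ≠ 0) (hdet : A.det = s ^ 2) :
    ∃ R U : Matrix ι ι F, (∀ i j, v (R i j) ≤ 1) ∧ U.IsSymm ∧ (∀ i j, v (U i j) ≤ 1) ∧
      v U.det = 1 ∧ Rᵀ * U * R = A := by
  have hs1 : v s ≤ 1 := by
    have hd : v.valuationSubring.subtype
        (Matrix.det (Matrix.of fun i j => (⟨A i j, hint i j⟩ : v.valuationSubring))) = A.det :=
      v.valuationSubring.subtype.map_det _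
    have : v A.det ≤ 1 := by
      rw [← hd]
      exact (Matrix.det (Matrix.of fun i j => (⟨A i j, hint i j⟩ : v.valuationSubring))).2
    rw [hdet, map_pow] at this
    exact (pow_le_one_iff _root_.two_ne_zero).1 this
  obtain ⟨k, hk⟩ : ∃ k : ℕ, v s = v π ^ k := by
    have hs0 : v s ≠ 0 := (v.ne_zero_iff).2 hs
    refine ⟨(-log (v s)).toNat, ?_⟩
    have hlog : log (v s) ≤ 0 := by rwa [log_le_iff_le_exp hs0, exp_zero]
    rw [h.map_eq, ← WithZero.exp_nsmul, ← exp_log hs0]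
    congr 1
    simp
    lia
  induction k generalizing A s with
  | zero =>
    refine ⟨1, A, fun i j => ?_, hA, hint, ?_, by simp⟩
    · rw [Matrix.one_apply]
      split_ifs <;> simp
    · rw [hdet, map_pow, hk, pow_zero, one_pow]
  | succ k ih =>
    have hπ : v π ≤ 1 := (h.lt_one_iff.2 le_rfl).le
    obtain ⟨R, A', t, hR, hA', hint', hRA, hdet', ht⟩ := h.exists_enlargement hA hint (by
      rw [hdet, map_pow, hk, map_mul, ← sq, pow_succ (v π) k]
      exact pow_le_pow_left' (mul_le_of_le_one_left' (pow_le_one₀ zero_le hπ)) 2)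
    have hst : v (s * t) = v π ^ k := by
      rw [map_mul, hk, pow_succ, mul_assoc, mul_comm (v π), ht, mul_one]
    have ht0 : t ≠ 0 := by
      rintro rfl
      simp at ht
    obtain ⟨R', U, hR', hU, hUint, hUdet, hRU⟩ := ih hA' hint' (mul_ne_zero hs ht0)
      (by rw [hdet', hdet, mul_pow]) (by
        rw [hst]
        exact pow_le_one₀ zero_le hπ) hst
    refine ⟨R' * R, U, fun i j => ?_, hU, hUint, hUdet, ?_⟩
    · exact Valuation.map_dotProduct_le_one (hR' i) fun k => hR k j
    · rw [← hRA, ← hRU, transpose_mul]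
      simp only [Matrix.mul_assoc]

omit h in
theorem _root_.Valuation.exists_ne_zero_map_mul_le_one (a : F) :
    ∃ c : F, c ≠ 0 ∧ v (c ^ 2 * a) ≤ 1 := by
  by_cases ha : v a ≤ 1
  · exact ⟨1, one_ne_zero, by simpa using ha⟩
  · have ha0 : a ≠ 0 := by
      rintro rfl
      simp at ha
    refine ⟨a⁻¹, inv_ne_zero ha0, ?_⟩
    rw [sq, mul_assoc, inv_mul_cancel₀ ha0, mul_one, map_inv₀]
    exact inv_le_one_of_one_le₀ (not_le.1 ha).le

theorem exists_transpose_mul_self_eq {n : ℕ} {G : Matrix (Fin n) (Fin n) F}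
    (hG : G.IsSymm) (hdet : G.det ≠ 0) :
    ∃ (a : Fin 3 → F) (S : Matrix (Fin (n + 3)) (Fin n ⊕ Fin 3) F), (∀ i, a i ≠ 0) ∧
      (∀ i, v (a i) ≤ 1) ∧ Sᵀ * S = fromBlocks G 0 0 (diagonal a) := by
  obtain ⟨R, d, hd, hR⟩ := exists_diagonalization h.two_ne_zero hG hdet
  have happ : ∀ x y : Fin (n + 3) → F,
      toBilin' (1 : Matrix (Fin (n + 3)) (Fin (n + 3)) F) x y = x ⬝ᵥ y := fun x y => by
    rw [toBilin'_apply', one_mulVec]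
  obtain ⟨e, w, he, hw⟩ := h.exists_orthogonal_family n
    (B := toBilin' (1 : Matrix (Fin (n + 3)) (Fin (n + 3)) F))
    ⟨fun x y => by simp only [happ, dotProduct_comm x y]⟩
    (LinearMap.BilinForm.nondegenerate_toBilin'_of_det_ne_zero' 1 (by simp)) (by simp) d hd
  simp only [happ] at hw
  choose c hc hce using fun i => Valuation.exists_ne_zero_map_mul_le_one (v := v) (e i)
  let W : Matrix (Fin (n + 3)) (Fin n ⊕ Fin 3) F := of fun i j => w j i
  have hW : Wᵀ * W = fromBlocks (diagonal d) 0 0 (diagonal e) := by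
    rw [fromBlocks_diagonal]
    ext i j
    exact (hw i j).trans (diagonal_apply ..).symm
  refine ⟨fun i => c i ^ 2 * e i, W * fromBlocks R 0 0 (diagonal c),
    fun i => mul_ne_zero (pow_ne_zero _ (hc i)) (he i), hce, ?_⟩
  calc (W * fromBlocks R 0 0 (diagonal c))ᵀ * (W * fromBlocks R 0 0 (diagonal c))
      = (fromBlocks R 0 0 (diagonal c))ᵀ * (Wᵀ * W) * fromBlocks R 0 0 (diagonal c) := by
        rw [transpose_mul]
        simp only [Matrix.mul_assoc]
    _ = _ := by
        rw [hW, fromBlocks_transpose, fromBlocks_multiply, fromBlocks_multiply]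
        simp [hR]
        exact fun i => by ring

theorem exists_unimodular_representing {n : ℕ} {G : Matrix (Fin n) (Fin n) F}
    (hG : G.IsSymm) (hint : ∀ i j, v (G i j) ≤ 1) (hdet : G.det ≠ 0) :
    ∃ (U P : Matrix (Fin (n + 3)) (Fin (n + 3)) F) (X : Matrix (Fin (n + 3)) (Fin n) F),
      U.IsSymm ∧ (∀ i j, v (U i j) ≤ 1) ∧ v U.det = 1 ∧ IsUnit P.det ∧ Pᵀ * U * P = 1 ∧
      (∀ i j, v (X i j) ≤ 1) ∧ Xᵀ * U * X = G := by
  obtain ⟨a, S₀, ha, ha1, hS₀⟩ := h.exists_transpose_mul_self_eq hG hdet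
  let A₀ := fromBlocks G 0 0 (diagonal a)
  let S := S₀.submatrix id finSumFinEquiv.symm
  let A := A₀.submatrix (finSumFinEquiv (m := n) (n := 3)).symm finSumFinEquiv.symm
  have hS : Sᵀ * S = A := by
    change _ = (fromBlocks G 0 0 (diagonal a)).submatrix _ _
    rw [← hS₀, ← submatrix_mul_equiv _ _ _ (Equiv.refl _)]
    rfl
  have hA0 : ∀ i j, v (A₀ i j) ≤ 1 := by
    rintro (i | i) (j | j)
    · exact hint i j
    · simp [A₀]
    · simp [A₀]
    · simp only [A₀, fromBlocks_apply₂₂, diagonal_apply]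
      split_ifs
      · exact ha1 i
      · simp
  have hAsymm : A.IsSymm := by
    rw [← hS]
    exact isSymm_transpose_mul_self S
  have hAdet : A.det = S.det ^ 2 := by rw [← hS, det_mul, det_transpose, sq]
  have hS0 : S.det ≠ 0 := by
    have : A.det ≠ 0 := by
      rw [det_submatrix_equiv_self, det_fromBlocks_zero₂₁, det_diagonal]
      exact mul_ne_zero hdet (Finset.prod_ne_zero_iff.2 fun i _ => ha i)
    rw [hAdet] at this
    exact pow_ne_zero_iff _root_.two_ne_zero |>.1 this
  obtain ⟨R, U, hR, hU, hUint, hUdet, hRU⟩ :=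
    h.exists_unimodular hAsymm (fun i j => hA0 _ _) hS0 hAdet
  have hP : (R * S⁻¹)ᵀ * U * (R * S⁻¹) = 1 := by
    have hSu : IsUnit S.det := hS0.isUnit
    calc (R * S⁻¹)ᵀ * U * (R * S⁻¹) = (S⁻¹)ᵀ * (Rᵀ * U * R) * S⁻¹ := by
          rw [transpose_mul]
          simp only [Matrix.mul_assoc]
      _ = (S * S⁻¹)ᵀ * (S * S⁻¹) := by
          rw [hRU, ← hS, transpose_mul]
          simp only [Matrix.mul_assoc]
      _ = 1 := by rw [mul_nonsing_inv _ hSu, transpose_one, Matrix.one_mul]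
  refine ⟨U, R * S⁻¹, R.submatrix id (Fin.castAdd 3), hU, hUint, hUdet, ?_, hP,
    fun i j => hR _ _, ?_⟩
  · have hd := congrArg det hP
    rw [det_mul, det_one] at hd
    exact IsUnit.of_mul_eq_one_right _ hd
  · ext i j
    refine (congrFun (congrFun hRU (Fin.castAdd 3 i)) (Fin.castAdd 3 j)).trans ?_
    simp [A, A₀]

end IsDyadicUniformizer

end

theorem stmt12 (K : Type) [Field K] [NumberField K] (htr : TotallyReal K)
    (𝔭 : HeightOneSpectrum (𝓞 K)) (hdyadic : (2 : 𝓞 K) ∈ 𝔭.asIdeal)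
    (n : ℕ) (hn : 1 ≤ n) (G : Matrix (Fin n) (Fin n) (𝔭.adicCompletion K))
    (hGint : ∀ i j, G i j ∈ 𝔭.adicCompletionIntegers K)
    (hGsymm : G.IsSymm) (hGdet : G.det ≠ 0) :
    ∃ (U : Matrix (Fin (n + 3)) (Fin (n + 3)) (𝔭.adicCompletion K))
      (P : Matrix (Fin (n + 3)) (Fin (n + 3)) (𝔭.adicCompletion K))
      (X : Matrix (Fin (n + 3)) (Fin n) (𝔭.adicCompletion K)),
      U.IsSymm ∧ (∀ i j, U i j ∈ 𝔭.adicCompletionIntegers K) ∧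
      (∃ u : (↥(𝔭.adicCompletionIntegers K))ˣ,
        ((u : ↥(𝔭.adicCompletionIntegers K)) : 𝔭.adicCompletion K) = U.det) ∧
      IsUnit P.det ∧ Pᵀ * U * P = (1 : Matrix (Fin (n + 3)) (Fin (n + 3)) (𝔭.adicCompletion K)) ∧
      (∀ i j, X i j ∈ 𝔭.adicCompletionIntegers K) ∧ Xᵀ * U * X = G := by
  obtain ⟨π, h⟩ := adicCompletion_exists_uniformizer 𝔭 hdyadic
  obtain ⟨U, P, X, hU, hUint, hUdet, hP, hPU, hX, hXU⟩ :=
    h.exists_unimodular_representing hGsymm hGint hGdet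
  have hu : IsUnit (⟨U.det, hUdet.le⟩ : 𝔭.adicCompletionIntegers K) :=
    HeightOneSpectrum.adicCompletionIntegers.isUnit_iff_valued_eq_one.2 hUdet
  exact ⟨U, P, X, hU, hUint, ⟨hu.unit, rfl⟩, hP, hPU, hX, hXU⟩
end
end

section
/- Let K be a totally real number field, let 𝔭 be a maximal ideal of O_K, and let n ≥ 1 be a fixed integer. For a positive integer m, let P(m) denote the statement: for every symmetric matrix G ∈ M_n(O_𝔭) with det G ≠ 0, there exist a symmetric matrix U ∈ M_m(O_𝔭) with det U a unit of O_𝔭 and a matrix X ∈ M_{m×n}(O_𝔭) with Xᵀ U X = G. If n = 1 or 𝔭 is dyadic, then P(m) holds if and only if m ≥ n + 1. If n ≥ 2 and 𝔭 is nondyadic, then P(m) holds if and only if m ≥ n + 2. -/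
open NumberField IsDedekindDomain Matrix

noncomputable section

/-- `P 𝔭 n m`: every nondegenerate `O_𝔭`-lattice of rank `n` (encoded by a symmetric
Gram matrix with entries in `O_𝔭` and nonzero determinant) is represented by some
unimodular `O_𝔭`-lattice of rank `m`. -/
def RepByUnimodular (K : Type) [Field K] [NumberField K]
    (𝔭 : HeightOneSpectrum (𝓞 K)) (n m : ℕ) : Prop :=
  ∀ G : Matrix (Fin n) (Fin n) (𝔭.adicCompletion K),
    (∀ i j, G i j ∈ 𝔭.adicCompletionIntegers K) → G.IsSymm → G.det ≠ 0 →
    ∃ (U : Matrix (Fin m) (Fin m) (𝔭.adicCompletion K))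
      (X : Matrix (Fin m) (Fin n) (𝔭.adicCompletion K)),
      U.IsSymm ∧ (∀ i j, U i j ∈ 𝔭.adicCompletionIntegers K) ∧
      (∃ u : (↥(𝔭.adicCompletionIntegers K))ˣ,
        ((u : ↥(𝔭.adicCompletionIntegers K)) : 𝔭.adicCompletion K) = U.det) ∧
      (∀ i j, X i j ∈ 𝔭.adicCompletionIntegers K) ∧ Xᵀ * U * X = G

theorem exists_smul_of_forall_dvd {R ι : Type*} [CommRing R] {ϖ : R} {x : ι → R}
    (h : ∀ i, ϖ ∣ x i) :
    ∃ y : ι → R, x = ϖ • y := by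
  choose y hy using h
  exact ⟨y, funext hy⟩

section FiniteField

variable {k : Type*} [Field k] [Finite k]

/-- Bilinear forms in three variables over a finite field are isotropic. -/
theorem exists_isotropic_fin_three (b : Matrix (Fin 3) (Fin 3) k) :
    ∃ x : Fin 3 → k, x ≠ 0 ∧ x ⬝ᵥ b *ᵥ x = 0 := by
  classical
  have := Fintype.ofFinite k
  obtain ⟨p, hp⟩ := CharP.exists k
  have hp1 : p ≠ 1 := CharP.char_ne_one k p
  let F : MvPolynomial (Fin 3) k :=
    ∑ i, ∑ j, MvPolynomial.C (b i j) * (MvPolynomial.X i * MvPolynomial.X j)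
  have hF : F.IsHomogeneous 2 :=
    MvPolynomial.IsHomogeneous.sum _ _ _ fun i _ => MvPolynomial.IsHomogeneous.sum _ _ _ fun j _ =>
      MvPolynomial.IsHomogeneous.C_mul
        ((MvPolynomial.isHomogeneous_X k i).mul (MvPolynomial.isHomogeneous_X k j)) _
  have heval : ∀ x, MvPolynomial.eval x F = x ⬝ᵥ b *ᵥ x := fun x => by
    simp only [F, map_sum, map_mul, MvPolynomial.eval_C, MvPolynomial.eval_X, dotProduct, mulVec,
      Finset.mul_sum]
    exact Finset.sum_congr rfl fun i _ => Finset.sum_congr rfl fun j _ => by ring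
  have hdvd := char_dvd_card_solutions p (f := F)
    (hF.totalDegree_le.trans_lt (by simp))
  by_contra! h
  have hone : Fintype.card {x // MvPolynomial.eval x F = 0} = 1 := by
    rw [Fintype.card_eq_one_iff]
    refine ⟨⟨0, by rw [heval]; simp⟩, fun y => Subtype.ext ?_⟩
    by_contra hy
    exact h _ hy (by rw [← heval]; exact y.2)
  rw [hone, Nat.dvd_one] at hdvd
  exact hp1 hdvd

/-- Binary symmetric bilinear forms over a finite field of characteristic two are isotropic. -/
theorem exists_isotropic_fin_two (h2 : (2 : k) = 0) (b : Matrix (Fin 2) (Fin 2) k)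
    (hb : b.IsSymm) : ∃ x : Fin 2 → k, x ≠ 0 ∧ x ⬝ᵥ b *ᵥ x = 0 := by
  have hchar : ringChar k = 2 :=
    CharP.ringChar_of_prime_eq_zero Nat.prime_two (by exact_mod_cast h2)
  obtain ⟨s, hs⟩ := FiniteField.isSquare_of_char_two hchar (b 0 0)
  obtain ⟨t, ht⟩ := FiniteField.isSquare_of_char_two hchar (b 1 1)
  have hb' : b 1 0 = b 0 1 := hb.apply 0 1
  by_cases h : s = 0
  · refine ⟨![1, 0], fun h => one_ne_zero (congrFun h 0), ?_⟩
    simp [dotProduct, mulVec, Fin.sum_univ_two, hs, h]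
  · refine ⟨![t, s], fun h' => h (congrFun h' 1), ?_⟩
    simp only [dotProduct, mulVec, Fin.sum_univ_two, cons_val_zero, cons_val_one, hs, ht, hb']
    linear_combination (t * s * b 0 1 + t ^ 2 * s ^ 2) * h2

end FiniteField

section Dvr

open IsLocalRing

variable {R : Type*} [CommRing R] [IsDomain R] [IsDiscreteValuationRing R]

/-- A Gram matrix is reduced with respect to `ϖ` if no `ϖ⁻¹ x` outside the lattice lies in the
dual lattice and has integral norm, i.e. none can be adjoined to the lattice. -/
def IsReducedGram {ι : Type*} [Fintype ι] (ϖ : R) (G : Matrix ι ι R) : Prop :=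
  ∀ x : ι → R, (∀ i, ϖ ∣ (G *ᵥ x) i) → ϖ ^ 2 ∣ x ⬝ᵥ G *ᵥ x → ∀ i, ϖ ∣ x i

theorem residue_eq_zero_iff_dvd {ϖ : R} (hϖ : Irreducible ϖ) (x : R) :
    residue R x = 0 ↔ ϖ ∣ x := by
  rw [residue_eq_zero_iff, hϖ.maximalIdeal_eq, Ideal.mem_span_singleton]

theorem exists_residue_comp {ι : Type*} (x : ι → ResidueField R) :
    ∃ y : ι → R, residue R ∘ y = x := by
  choose y hy using fun i => residue_surjective (x i)
  exact ⟨y, funext hy⟩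

theorem map_residue_mulVec {ι κ : Type*} [Fintype ι] (M : Matrix κ ι R) (x : ι → R) :
    M.map (residue R) *ᵥ (residue R ∘ x) = residue R ∘ (M *ᵥ x) :=
  funext fun i => ((residue R).map_mulVec M x i).symm

variable {ι : Type*} [Fintype ι] [DecidableEq ι]

/-- A lattice that is not reduced is contained in one of strictly smaller discriminant. -/
theorem exists_overlattice {ϖ : R} (hϖ : Irreducible ϖ) {G : Matrix ι ι R} (hG : G.IsSymm)
    (hdet : G.det ≠ 0) (hred : ¬ IsReducedGram ϖ G) :
    ∃ H S : Matrix ι ι R, H.IsSymm ∧ DvdNotUnit H.det G.det ∧ Sᵀ * H * S = G := by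
  simp only [IsReducedGram, not_forall] at hred
  obtain ⟨x, hx, hxx, j, hj⟩ := hred
  have hxj : IsUnit (x j) := by
    by_contra h
    rw [← residue_ne_zero_iff_isUnit, not_not, residue_eq_zero_iff_dvd hϖ] at h
    exact hj h
  have hϖ0 : ϖ ≠ 0 := hϖ.ne_zero
  set T : Matrix ι ι R := (1 : Matrix ι ι R).updateCol j x with hT
  have hTdet : T.det = x j := by
    rw [hT, ← cramer_apply, cramer_one]; rfl
  have hTcol : ∀ i, T i j = x i := fun i => by simp [hT]
  have hTs : T.col j = x := funext hTcol
  set N := Tᵀ * G * T with hN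
  have hNs : N.IsSymm := by
    simp [hN, IsSymm, Matrix.transpose_mul, hG.eq, Matrix.mul_assoc]
  have hNcol : ∀ i, N i j = (Tᵀ *ᵥ (G *ᵥ x)) i := fun i => by
    have : N i j = (N *ᵥ Pi.single j 1) i := by simp
    rw [this, hN, ← mulVec_mulVec, ← mulVec_mulVec, mulVec_single_one, hTs]
  have hNj : ∀ i, ϖ ∣ N i j := fun i => by
    rw [hNcol]
    exact Finset.dvd_sum fun l _ => (hx l).mul_left _
  have hNjj : ϖ ^ 2 ∣ N j j := by
    rw [hNcol]
    convert hxx using 1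
    simp [mulVec, dotProduct, hTcol]
  set D : ι → R := Function.update 1 j ϖ with hD
  have hD0 : ∀ i, D i ≠ 0 := fun i => by
    by_cases h : i = j
    · subst h; simp [hD, hϖ0]
    · simp [hD, h]
  have hq : ∀ i l, ∃ q, N i l = D i * q * D l := fun i l => by
    by_cases hi : i = j <;> by_cases hl : l = j
    · subst hi; subst hl
      obtain ⟨q, hq⟩ := hNjj
      exact ⟨q, by simp [hD, hq]; ring⟩
    · subst hi
      obtain ⟨q, hq⟩ := hNj l
      exact ⟨q, by rw [← hNs.apply, hq]; simp [hD, hl]⟩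
    · subst hl
      obtain ⟨q, hq⟩ := hNj i
      exact ⟨q, by rw [hq]; simp [hD, hi, mul_comm]⟩
    · exact ⟨N i l, by simp [hD, hi, hl]⟩
  choose H hH using hq
  have hND : N = diagonal D * of H * diagonal D := by
    ext i l
    simp [hH]
  have hDdet : (diagonal D).det = ϖ := by
    rw [det_diagonal, hD, Finset.prod_update_of_mem (Finset.mem_univ j)]
    simp
  have hTu : IsUnit T.det := hTdet ▸ hxj
  have hdetN : N.det = G.det * x j ^ 2 := by
    rw [hN, det_mul, det_mul, det_transpose, hTdet]; ring
  have hdetN' : N.det = (of H).det * ϖ ^ 2 := by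
    rw [hND, det_mul, det_mul, hDdet]; ring
  obtain ⟨u, hu⟩ := hxj
  have hGdet : G.det = (of H).det * (ϖ ^ 2 * (↑u⁻¹ : R) ^ 2) := by
    rw [← mul_assoc, ← hdetN', hdetN, ← hu, mul_assoc, ← mul_pow]; simp
  refine ⟨of H, diagonal D * T⁻¹, ?_, ⟨?_, _, ?_, hGdet⟩, ?_⟩
  · ext i l
    have h1 := hH i l
    rw [← hNs.apply, hH l i] at h1
    have : D i * D l ≠ 0 := mul_ne_zero (hD0 i) (hD0 l)
    apply mul_left_cancel₀ this
    simp only [transpose_apply, of_apply]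
    linear_combination h1
  · intro h
    rw [h, zero_mul] at hGdet
    exact hdet hGdet
  · intro h
    exact hϖ.not_isUnit ((isUnit_pow_iff two_ne_zero).1 (isUnit_of_mul_isUnit_left h))
  · rw [transpose_mul, diagonal_transpose]
    calc T⁻¹ᵀ * diagonal D * of H * (diagonal D * T⁻¹)
        = T⁻¹ᵀ * (diagonal D * of H * diagonal D) * T⁻¹ := by
          simp only [Matrix.mul_assoc]
      _ = T⁻¹ᵀ * Tᵀ * G * (T * T⁻¹) := by rw [← hND, hN]; simp only [Matrix.mul_assoc]
      _ = G := by
          rw [← transpose_mul, mul_nonsing_inv T hTu]; simp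

/-- Every nondegenerate lattice is contained in a reduced one. -/
theorem exists_reduced_overlattice {ϖ : R} (hϖ : Irreducible ϖ) (G : Matrix ι ι R)
    (hG : G.IsSymm) (hdet : G.det ≠ 0) :
    ∃ H S : Matrix ι ι R, H.IsSymm ∧ IsReducedGram ϖ H ∧ Sᵀ * H * S = G := by
  suffices ∀ d, ∀ G : Matrix ι ι R, G.det = d → G.IsSymm → d ≠ 0 →
      ∃ H S : Matrix ι ι R, H.IsSymm ∧ IsReducedGram ϖ H ∧ Sᵀ * H * S = G from
    this _ G rfl hG hdet
  intro d
  apply wellFounded_dvdNotUnit.induction d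
  rintro _ ih G rfl hG hdet
  by_cases hred : IsReducedGram ϖ G
  · exact ⟨G, 1, hG, hred, by simp⟩
  · obtain ⟨H, S, hH, hlt, hS⟩ := exists_overlattice hϖ hG hdet hred
    obtain ⟨H', S', hH', hr, hS'⟩ := ih _ hlt H rfl hH hlt.1
    refine ⟨H', S' * S, hH', hr, ?_⟩
    rw [← hS, ← hS', transpose_mul]
    simp only [Matrix.mul_assoc]

/-- If every symmetric bilinear form in `d` variables over the residue field is isotropic, then
the radical of the reduction of a reduced Gram matrix has dimension less than `d`. -/
theorem finrank_ker_lt_of_isotropic {ι : Type*} [Fintype ι] {ϖ : R} (hϖ : Irreducible ϖ)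
    {G : Matrix ι ι R}
    (hG : G.IsSymm) (hred : IsReducedGram ϖ G) (d : ℕ)
    (hiso : ∀ b : Matrix (Fin d) (Fin d) (ResidueField R), b.IsSymm →
      ∃ x : Fin d → ResidueField R, x ≠ 0 ∧ x ⬝ᵥ b *ᵥ x = 0) :
    Module.finrank (ResidueField R) (LinearMap.ker (G.map (residue R)).mulVecLin) < d := by
  by_contra! hd
  obtain ⟨w, hw⟩ := exists_linearIndependent_of_le_finrank hd
  have hw' := hw.map' (LinearMap.ker (G.map (residue R)).mulVecLin).subtype
    (Submodule.ker_subtype _)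
  choose X hX using fun i => exists_residue_comp (w i : ι → ResidueField R)
  have hGX : ∀ i, ∃ y : ι → R, G *ᵥ X i = ϖ • y := fun i => by
    apply exists_smul_of_forall_dvd
    intro l
    rw [← residue_eq_zero_iff_dvd hϖ, ← Function.comp_apply (f := residue R),
      ← map_residue_mulVec, hX]
    exact congrFun (w i).2 l
  choose y hy using hGX
  have hdot : ∀ u v, u ⬝ᵥ G *ᵥ v = v ⬝ᵥ G *ᵥ u := fun u v => by
    rw [dotProduct_mulVec, ← mulVec_transpose, hG.eq, dotProduct_comm]
  set b : Matrix (Fin d) (Fin d) R := of fun i j => X i ⬝ᵥ y j with hb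
  have hbs : b.IsSymm := by
    ext i j
    have := hdot (X j) (X i)
    rw [hy, hy, dotProduct_smul, dotProduct_smul] at this
    exact mul_left_cancel₀ hϖ.ne_zero this
  obtain ⟨x, hx0, hx⟩ := hiso (b.map (residue R)) (hbs.map _)
  obtain ⟨s, rfl⟩ := exists_residue_comp x
  have hGv : G *ᵥ (∑ i, s i • X i) = ϖ • ∑ i, s i • y i := by
    simp only [mulVec_sum, mulVec_smul, hy, Finset.smul_sum]
    exact Finset.sum_congr rfl fun i _ => smul_comm _ _ _
  have hv := hred (∑ i, s i • X i) (fun l => by rw [hGv]; exact ⟨_, rfl⟩) ?_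
  · apply hx0
    funext i
    refine Fintype.linearIndependent_iff.1 hw' (residue R ∘ s) ?_ i
    funext l
    have := (residue_eq_zero_iff_dvd hϖ _).2 (hv l)
    simp only [Finset.sum_apply, Pi.smul_apply, smul_eq_mul, map_sum, map_mul] at this
    simp only [Finset.sum_apply, Pi.smul_apply, smul_eq_mul, Function.comp_apply,
      Submodule.subtype_apply, ← hX, Pi.zero_apply]
    exact this
  · rw [hGv, dotProduct_smul, pow_two]
    refine mul_dvd_mul_left _ ?_
    rw [← residue_eq_zero_iff_dvd hϖ]
    rw [map_residue_mulVec, ← RingHom.map_dotProduct] at hx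
    convert hx using 2
    simp only [hb, sum_dotProduct, dotProduct_sum, smul_dotProduct, dotProduct_smul, smul_eq_mul]
    simp only [mulVec, dotProduct, Finset.mul_sum, Finset.sum_mul, of_apply]
    rw [Finset.sum_comm]
    exact Finset.sum_congr rfl fun i _ => Finset.sum_congr rfl fun j _ =>
      Finset.sum_congr rfl fun l _ => by ring

/-- A reduced lattice with `r`-dimensional radical modulo `ϖ` is represented by unimodular lattices
only in codimension at least `r`. -/
theorem card_add_finrank_ker_le {ι κ : Type*} [Fintype ι] [Fintype κ] [DecidableEq κ] {ϖ : R}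
    (hϖ : Irreducible ϖ) {G : Matrix ι ι R} (hred : IsReducedGram ϖ G) {U : Matrix κ κ R}
    (hU : IsUnit U.det) {X : Matrix κ ι R} (hX : Xᵀ * U * X = G) :
    Fintype.card ι + Module.finrank (ResidueField R)
      (LinearMap.ker (G.map (residue R)).mulVecLin) ≤ Fintype.card κ := by
  set f := residue R
  have hXinj : LinearMap.ker (X.map f).mulVecLin = ⊥ := by
    rw [LinearMap.ker_eq_bot']
    intro v hv
    obtain ⟨x, rfl⟩ := exists_residue_comp v
    rw [mulVecLin_apply, map_residue_mulVec] at hv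
    obtain ⟨y, hy⟩ := exists_smul_of_forall_dvd (x := X *ᵥ x) fun i =>
      (residue_eq_zero_iff_dvd hϖ _).1 (congrFun hv i)
    have hGx : G *ᵥ x = ϖ • Xᵀ *ᵥ (U *ᵥ y) := by
      rw [← hX, ← mulVec_mulVec, hy, mulVec_smul, ← mulVec_mulVec]
    funext i
    refine (residue_eq_zero_iff_dvd hϖ _).2 (hred x (fun l => by rw [hGx]; exact ⟨_, rfl⟩) ?_ i)
    rw [hGx, dotProduct_smul, dotProduct_mulVec, vecMul_transpose, hy, smul_dotProduct, pow_two]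
    exact ⟨y ⬝ᵥ U *ᵥ y, by simp [mul_assoc]⟩
  have hUinj : Function.Injective (U.map f).mulVec := by
    rw [mulVec_injective_iff_isUnit, isUnit_iff_isUnit_det]
    have := hU.map f
    rwa [RingHom.map_det] at this
  have hGf : (X.map f)ᵀ * U.map f * X.map f = G.map f := by
    rw [← hX, Matrix.map_mul, Matrix.map_mul, transpose_map]
  have h1 := LinearMap.finrank_range_add_finrank_ker (X.map f).mulVecLin
  have h2 := LinearMap.finrank_range_add_finrank_ker (X.map f)ᵀ.mulVecLin
  have h3 : Module.finrank (ResidueField R) (LinearMap.range (X.map f)ᵀ.mulVecLin) =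
      Module.finrank (ResidueField R) (LinearMap.range (X.map f).mulVecLin) :=
    rank_transpose _
  let g : LinearMap.ker (G.map f).mulVecLin →ₗ[ResidueField R]
      LinearMap.ker (X.map f)ᵀ.mulVecLin :=
    ((U.map f).mulVecLin ∘ₗ (X.map f).mulVecLin).restrict fun v hv => by
      rw [LinearMap.mem_ker, mulVecLin_apply] at hv ⊢
      rw [← hGf, ← mulVec_mulVec, ← mulVec_mulVec] at hv
      exact hv
  have hg : Function.Injective g := fun a b hab => by
    have := hUinj (congrArg Subtype.val hab)
    exact Subtype.ext (LinearMap.ker_eq_bot.1 hXinj this)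
  have h4 := LinearMap.finrank_le_finrank_of_injective hg
  rw [hXinj, finrank_bot] at h1
  rw [Module.finrank_pi] at h1 h2
  omega

/-- A lattice whose radical modulo the maximal ideal has dimension `r` is represented by a
unimodular lattice in codimension `r`. -/
theorem exists_unimodular_of_finrank_ker_eq {G : Matrix ι ι R} (hG : G.IsSymm) {r : ℕ}
    (hr : Module.finrank (ResidueField R)
      (LinearMap.ker (G.map (residue R)).mulVecLin) = r) :
    ∃ (U : Matrix (ι ⊕ Fin r) (ι ⊕ Fin r) R) (X : Matrix (ι ⊕ Fin r) ι R),
      U.IsSymm ∧ IsUnit U.det ∧ Xᵀ * U * X = G := by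
  set f := residue R
  set W := LinearMap.ker (G.map f).mulVecLin with hW
  let e : W ≃ₗ[ResidueField R] (Fin r → ResidueField R) :=
    LinearEquiv.ofFinrankEq _ _ (by simp [hr])
  obtain ⟨g, hg⟩ := LinearMap.exists_extend e.toLinearMap
  have hg' : ∀ w : W, g w = e w := fun w => congrFun (congrArg DFunLike.coe hg) w
  obtain ⟨C, hC⟩ : ∃ C : Matrix (Fin r) ι R, C.map f = LinearMap.toMatrix' g := by
    choose C hC using fun i j => residue_surjective (LinearMap.toMatrix' g i j)
    exact ⟨of C, by ext i j; exact hC i j⟩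
  have hCg : ∀ v, C.map f *ᵥ v = g v := fun v => by
    rw [hC, ← toLin'_apply, toLin'_toMatrix']
  refine ⟨fromBlocks G Cᵀ C 0, fromRows 1 0, ?_, ?_, ?_⟩
  · rw [IsSymm, fromBlocks_transpose, hG.eq]; simp
  · rw [← residue_ne_zero_iff_isUnit, RingHom.map_det, ne_eq, ← exists_mulVec_eq_zero_iff]
    rintro ⟨v, hv0, hv⟩
    apply hv0
    rw [RingHom.mapMatrix_apply, fromBlocks_map, fromBlocks_mulVec, ← Sum.elim_zero_zero] at hv
    have h1 := congrArg (· ∘ Sum.inl) hv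
    have h2 := congrArg (· ∘ Sum.inr) hv
    simp only [Sum.elim_comp_inl, Sum.elim_comp_inr] at h1 h2
    rw [Matrix.map_zero _ (map_zero _), zero_mulVec, add_zero, hCg] at h2
    rw [transpose_map] at h1
    have hy : v ∘ Sum.inr = 0 := by
      apply dotProduct_eq_zero
      intro z
      set w := e.symm z
      have hw : G.map f *ᵥ w = 0 := w.2
      have hz : C.map f *ᵥ w = z := by rw [hCg, hg', e.apply_symm_apply]
      have := congrArg (fun u => (w : ι → ResidueField R) ⬝ᵥ u) h1
      simp only [dotProduct_add, dotProduct_zero] at this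
      rw [dotProduct_mulVec, dotProduct_mulVec, ← mulVec_transpose, (hG.map _).eq, hw,
        vecMul_transpose, hz, zero_dotProduct, zero_add, dotProduct_comm] at this
      exact this
    rw [hy, mulVec_zero, add_zero] at h1
    have hx : v ∘ Sum.inl = 0 := by
      have h := hg' ⟨v ∘ Sum.inl, h1⟩
      rw [h2] at h
      exact congrArg Subtype.val (e.map_eq_zero_iff.1 h.symm)
    rw [← Sum.elim_comp_inl_inr v, hx, hy]
    simp
  · rw [transpose_fromRows, fromCols_mul_fromBlocks, fromCols_mul_fromRows]
    simp

/-- A unimodular representation of codimension `r` extends to any larger codimension. -/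
theorem exists_unimodular_of_finrank_ker_le {G : Matrix ι ι R} (hG : G.IsSymm) {m : ℕ}
    (hm : Fintype.card ι + Module.finrank (ResidueField R)
      (LinearMap.ker (G.map (residue R)).mulVecLin) ≤ m) :
    ∃ (U : Matrix (Fin m) (Fin m) R) (X : Matrix (Fin m) ι R),
      U.IsSymm ∧ IsUnit U.det ∧ Xᵀ * U * X = G := by
  obtain ⟨U, X, hU, hdet, hX⟩ := exists_unimodular_of_finrank_ker_eq hG rfl
  obtain ⟨s, rfl⟩ := Nat.exists_eq_add_of_le hm
  let e : (ι ⊕ Fin (Module.finrank (ResidueField R)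
      (LinearMap.ker (G.map (residue R)).mulVecLin))) ⊕ Fin s ≃ Fin (Fintype.card ι +
      Module.finrank (ResidueField R) (LinearMap.ker (G.map (residue R)).mulVecLin) + s) :=
    Fintype.equivFinOfCardEq (by simp)
  refine ⟨(fromBlocks U 0 0 1).submatrix e.symm e.symm, (fromRows X 0).submatrix e.symm id,
    ?_, ?_, ?_⟩
  · apply IsSymm.submatrix
    rw [IsSymm, fromBlocks_transpose, hU.eq]; simp
  · rw [det_submatrix_equiv_self, det_fromBlocks_zero₂₁]
    simpa using hdet
  · rw [transpose_submatrix, submatrix_mul_equiv, submatrix_mul_equiv, transpose_fromRows,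
      fromCols_mul_fromBlocks, fromCols_mul_fromRows]
    simpa using hX

/-- Scaling an anisotropic diagonal form by `ϖ` and adding a unit form gives a reduced form. -/
theorem isReducedGram_diagonal {R ι : Type*} [CommRing R] [IsDomain R] [Fintype ι] [DecidableEq ι]
    {ϖ : R} (hϖ : Irreducible ϖ) (s : Finset ι) (a : ι → R)
    (ha : ∀ x : ι → R, ϖ ∣ ∑ i ∈ s, a i * x i ^ 2 → ∀ i ∈ s, ϖ ∣ x i) :
    IsReducedGram ϖ (diagonal fun i => if i ∈ s then ϖ * a i else 1) := by
  intro x hx hxx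
  have hout : ∀ i ∉ s, ϖ ∣ x i := fun i hi => by simpa [mulVec_diagonal, hi] using hx i
  have hsum : x ⬝ᵥ (diagonal fun i => if i ∈ s then ϖ * a i else 1) *ᵥ x =
      ϖ * ∑ i ∈ s, a i * x i ^ 2 + ∑ i ∈ sᶜ, x i ^ 2 := by
    simp only [dotProduct, mulVec_diagonal]
    rw [← Finset.sum_add_sum_compl s, Finset.mul_sum]
    congr 1
    · exact Finset.sum_congr rfl fun i hi => by rw [if_pos hi]; ring
    · exact Finset.sum_congr rfl fun i hi => by rw [if_neg (Finset.mem_compl.1 hi)]; ring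
  have hc : ϖ ^ 2 ∣ ∑ i ∈ sᶜ, x i ^ 2 :=
    Finset.dvd_sum fun i hi => pow_dvd_pow_of_dvd (hout i (Finset.mem_compl.1 hi)) 2
  rw [hsum, dvd_add_left hc, pow_two, mul_dvd_mul_iff_left hϖ.ne_zero] at hxx
  intro i
  by_cases hi : i ∈ s
  · exact ha x hxx i hi
  · exact hout i hi

theorem finrank_ker_diagonal {ϖ : R} (hϖ : Irreducible ϖ) (s : Finset ι) (a : ι → R) :
    Module.finrank (ResidueField R) (LinearMap.ker ((diagonal fun i =>
      if i ∈ s then ϖ * a i else 1).map (residue R)).mulVecLin) = s.card := by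
  classical
  have hϖ0 : residue R ϖ = 0 := (residue_eq_zero_iff_dvd hϖ _).2 dvd_rfl
  rw [diagonal_map (map_zero _)]
  have h := LinearMap.finrank_range_add_finrank_ker
    (diagonal fun i => residue R (if i ∈ s then ϖ * a i else 1)).mulVecLin
  have hr := rank_diagonal fun i => residue R (if i ∈ s then ϖ * a i else 1)
  have hs : Fintype.card {i // residue R (if i ∈ s then ϖ * a i else 1) ≠ 0} = sᶜ.card := by
    rw [Fintype.card_subtype]
    congr 1
    ext i
    by_cases hi : i ∈ s <;> simp [hi, hϖ.not_isUnit]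
  rw [hs, Matrix.rank] at hr
  rw [hr, Module.finrank_pi, Finset.card_compl] at h
  have := s.card_le_univ
  omega

/-- Every nondegenerate lattice of rank `n` over `R` is represented by a unimodular lattice of
rank `m`. -/
def AllRepByUnimodular (R : Type*) [CommRing R] (n m : ℕ) : Prop :=
  ∀ G : Matrix (Fin n) (Fin n) R, G.IsSymm → G.det ≠ 0 →
    ∃ (U : Matrix (Fin m) (Fin m) R) (X : Matrix (Fin m) (Fin n) R),
      U.IsSymm ∧ IsUnit U.det ∧ Xᵀ * U * X = G

theorem AllRepByUnimodular.add_card_le {ϖ : R} (hϖ : Irreducible ϖ) {n m : ℕ}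
    (h : AllRepByUnimodular R n m) (s : Finset (Fin n)) (a : Fin n → R) (ha0 : ∀ i, a i ≠ 0)
    (ha : ∀ x : Fin n → R, ϖ ∣ ∑ i ∈ s, a i * x i ^ 2 → ∀ i ∈ s, ϖ ∣ x i) :
    n + s.card ≤ m := by
  obtain ⟨U, X, -, hU, hX⟩ := h (diagonal fun i => if i ∈ s then ϖ * a i else 1)
    (diagonal_transpose _) (by
      rw [det_diagonal, Finset.prod_ne_zero_iff]
      intro i _
      split_ifs
      · exact mul_ne_zero hϖ.ne_zero (ha0 i)
      · exact one_ne_zero)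
  have := card_add_finrank_ker_le hϖ (isReducedGram_diagonal hϖ s a ha) hU hX
  rwa [finrank_ker_diagonal hϖ, Fintype.card_fin, Fintype.card_fin] at this

theorem AllRepByUnimodular.add_one_le {n m : ℕ} (hn : 1 ≤ n) (h : AllRepByUnimodular R n m) :
    n + 1 ≤ m := by
  obtain ⟨ϖ, hϖ⟩ := IsDiscreteValuationRing.exists_irreducible R
  refine h.add_card_le hϖ {⟨0, hn⟩} 1 (fun _ => one_ne_zero) fun x hx i hi => ?_
  rw [Finset.mem_singleton.1 hi]
  exact hϖ.prime.dvd_of_dvd_pow (by simpa using hx)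

theorem AllRepByUnimodular.add_two_le [Finite (ResidueField R)] (h2 : (2 : ResidueField R) ≠ 0)
    {n m : ℕ} (hn : 2 ≤ n) (h : AllRepByUnimodular R n m) : n + 2 ≤ m := by
  obtain ⟨ϖ, hϖ⟩ := IsDiscreteValuationRing.exists_irreducible R
  have hchar : ringChar (ResidueField R) ≠ 2 := fun hc => h2 (by
    exact_mod_cast (ringChar.spec (ResidueField R) 2).2 hc.dvd)
  obtain ⟨δ, hδ⟩ := FiniteField.exists_nonsquare hchar
  obtain ⟨d, rfl⟩ := residue_surjective δ
  have hd0 : d ≠ 0 := by rintro rfl; simp at hδ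
  let i₀ : Fin n := ⟨0, by omega⟩
  let i₁ : Fin n := ⟨1, by omega⟩
  have hne : i₀ ≠ i₁ := by simp [i₀, i₁]
  have := h.add_card_le hϖ {i₀, i₁} (fun i => if i = i₀ then 1 else -d)
    (fun i => by split_ifs <;> simp [hd0]) fun x hx => ?_
  · rwa [Finset.card_pair hne] at this
  rw [Finset.sum_pair hne, if_pos rfl, if_neg hne.symm, ← residue_eq_zero_iff_dvd hϖ] at hx
  simp only [map_add, map_mul, map_pow, map_neg, map_one] at hx
  have hx1 : residue R (x i₁) = 0 := by
    by_contra h0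
    refine hδ ⟨residue R (x i₀) / residue R (x i₁), ?_⟩
    field_simp
    linear_combination -hx
  have hx0 : residue R (x i₀) = 0 := by simpa [hx1] using hx
  intro i hi
  rw [← residue_eq_zero_iff_dvd hϖ]
  rcases Finset.mem_insert.1 hi with rfl | hi
  · exact hx0
  · rwa [Finset.mem_singleton.1 hi]

theorem allRepByUnimodular_of_forall_reduced {ϖ : R} (hϖ : Irreducible ϖ) {n m d : ℕ}
    (hd : ∀ G : Matrix (Fin n) (Fin n) R, G.IsSymm → IsReducedGram ϖ G →
      Module.finrank (ResidueField R) (LinearMap.ker (G.map (residue R)).mulVecLin) ≤ d)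
    (hm : n + d ≤ m) : AllRepByUnimodular R n m := by
  intro G hG hdet
  obtain ⟨H, S, hH, hred, hS⟩ := exists_reduced_overlattice hϖ G hG hdet
  have hle := hd H hH hred
  obtain ⟨U, X, hU, hUdet, hX⟩ := exists_unimodular_of_finrank_ker_le (m := m) hH
    (by rw [Fintype.card_fin]; omega)
  refine ⟨U, X * S, hU, hUdet, ?_⟩
  rw [← hS, ← hX, transpose_mul]
  simp only [Matrix.mul_assoc]

theorem allRepByUnimodular_of_add_two_le [Finite (ResidueField R)] {n m : ℕ} (hm : n + 2 ≤ m) :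
    AllRepByUnimodular R n m := by
  obtain ⟨ϖ, hϖ⟩ := IsDiscreteValuationRing.exists_irreducible R
  exact allRepByUnimodular_of_forall_reduced hϖ (fun G hG hred => Nat.lt_succ_iff.1
    (finrank_ker_lt_of_isotropic hϖ hG hred 3 fun b _ => exists_isotropic_fin_three b)) hm

theorem allRepByUnimodular_of_add_one_le [Finite (ResidueField R)] {n m : ℕ}
    (h : n = 1 ∨ (2 : ResidueField R) = 0) (hm : n + 1 ≤ m) : AllRepByUnimodular R n m := by
  obtain ⟨ϖ, hϖ⟩ := IsDiscreteValuationRing.exists_irreducible R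
  refine allRepByUnimodular_of_forall_reduced hϖ (fun G hG hred => ?_) hm
  rcases h with rfl | h
  · exact (Submodule.finrank_le _).trans (by simp)
  · exact Nat.lt_succ_iff.1
      (finrank_ker_lt_of_isotropic hϖ hG hred 2 (exists_isotropic_fin_two h))

end Dvr

section AdicCompletion

open IsLocalRing

variable {K : Type} [Field K] [NumberField K] (𝔭 : HeightOneSpectrum (𝓞 K))

theorem repByUnimodular_iff (n m : ℕ) :
    RepByUnimodular K 𝔭 n m ↔ AllRepByUnimodular (𝔭.adicCompletionIntegers K) n m := by
  set O := 𝔭.adicCompletionIntegers K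
  have hinj : Function.Injective O.subtype := Subtype.val_injective
  have hdet : ∀ {l : ℕ} (A : Matrix (Fin l) (Fin l) O), (A.map O.subtype).det = O.subtype A.det :=
    fun A => (RingHom.map_det O.subtype A).symm
  have hlift : ∀ {l l' : ℕ} (A : Matrix (Fin l) (Fin l') (𝔭.adicCompletion K)),
      (∀ i j, A i j ∈ O) → ∃ B : Matrix (Fin l) (Fin l') O, B.map O.subtype = A :=
    fun A hA => ⟨of fun i j => ⟨A i j, hA i j⟩, rfl⟩
  have hsymm : ∀ {l : ℕ} (A : Matrix (Fin l) (Fin l) O), (A.map O.subtype).IsSymm ↔ A.IsSymm :=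
    fun A => ⟨fun h => map_injective hinj h, fun h => h.map _⟩
  constructor
  · intro h G hG hGdet
    obtain ⟨U, X, hU, hUm, ⟨u, hu⟩, hXm, hX⟩ := h (G.map O.subtype) (fun i j => (G i j).2)
      ((hsymm G).2 hG) (by rw [hdet]; exact fun h0 => hGdet (hinj (by rw [h0, map_zero])))
    obtain ⟨U, rfl⟩ := hlift U hUm
    obtain ⟨X, rfl⟩ := hlift X hXm
    refine ⟨U, X, (hsymm U).1 hU, ⟨u, hinj (by rw [← hdet]; exact hu)⟩, map_injective hinj ?_⟩
    dsimp only
    rw [Matrix.map_mul, Matrix.map_mul]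
    exact hX
  · intro h G hGm hG hGdet
    obtain ⟨G, rfl⟩ := hlift G hGm
    obtain ⟨U, X, hU, ⟨u, hu⟩, hX⟩ := h G ((hsymm G).1 hG)
      (fun h0 => hGdet (by rw [hdet, h0, map_zero]))
    refine ⟨U.map O.subtype, X.map O.subtype, (hsymm U).2 hU, fun i j => (U i j).2,
      ⟨u, by rw [hdet, hu]; rfl⟩, fun i j => (X i j).2, ?_⟩
    rw [← hX, Matrix.map_mul, Matrix.map_mul, transpose_map]

theorem residue_eq_zero_iff_valued_lt_one (x : 𝔭.adicCompletionIntegers K) :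
    residue _ x = 0 ↔ Valued.v (x : 𝔭.adicCompletion K) < 1 := by
  rw [residue_eq_zero_iff]
  exact Valuation.mem_maximalIdeal_iff _ _

theorem residue_algebraMap_eq_zero_iff (r : 𝓞 K) :
    residue (𝔭.adicCompletionIntegers K) (algebraMap _ _ r) = 0 ↔ r ∈ 𝔭.asIdeal := by
  rw [residue_eq_zero_iff_valued_lt_one, ← 𝔭.valuation_lt_one_iff_mem (K := K)]
  exact iff_of_eq (congrArg (· < 1) (𝔭.valuedAdicCompletion_eq_valuation' (algebraMap _ K r)))

theorem residue_comp_algebraMap_surjective :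
    Function.Surjective ((residue (𝔭.adicCompletionIntegers K)).comp (algebraMap (𝓞 K) _)) := by
  intro y
  obtain ⟨x, rfl⟩ := residue_surjective y
  have hball : {z | Valued.v (z - (x : 𝔭.adicCompletion K)) < 1} ∈
      nhds (x : 𝔭.adicCompletion K) :=
    Valued.mem_nhds.2 ⟨1, fun z hz => Valued.v.restrict_lt_one_iff.1 hz⟩
  obtain ⟨c, hc⟩ := (𝔭.denseRange_algebraMap K).mem_nhds hball
  have hcv : Valued.v (algebraMap K (𝔭.adicCompletion K) c) = 𝔭.valuation K c :=
    𝔭.valuedAdicCompletion_eq_valuation' c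
  have hc1 : 𝔭.valuation K c ≤ 1 := by
    rw [← hcv, ← sub_add_cancel (algebraMap K (𝔭.adicCompletion K) c) x]
    exact (Valued.v.map_add _ _).trans (max_le (le_of_lt hc) x.2)
  obtain ⟨a, ha⟩ := 𝔭.exists_valuation_sub_lt_of_integer hc1 1
  refine ⟨a, sub_eq_zero.1 ?_⟩
  rw [RingHom.comp_apply, ← map_sub, residue_eq_zero_iff_valued_lt_one]
  have hac : Valued.v (algebraMap K (𝔭.adicCompletion K) (algebraMap (𝓞 K) K a - c)) < 1 :=
    (𝔭.valuedAdicCompletion_eq_valuation' _).trans_lt ha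
  have := Valued.v.map_add_lt hac hc
  rwa [map_sub, sub_add_sub_cancel] at this

instance finite_residueField : Finite (ResidueField (𝔭.adicCompletionIntegers K)) := by
  set f := (residue (𝔭.adicCompletionIntegers K)).comp (algebraMap (𝓞 K) _)
  have hker : RingHom.ker f = 𝔭.asIdeal := by
    ext r
    exact residue_algebraMap_eq_zero_iff 𝔭 r
  have : Finite (𝓞 K ⧸ 𝔭.asIdeal) := Ideal.finiteQuotientOfFreeOfNeBot _ 𝔭.ne_bot
  have : Finite (𝓞 K ⧸ RingHom.ker f) := hker ▸ this
  exact Finite.of_equiv _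
    (RingHom.quotientKerEquivOfSurjective (residue_comp_algebraMap_surjective 𝔭)).toEquiv

end AdicCompletion

theorem stmt13 (K : Type) [Field K] [NumberField K] (htr : TotallyReal K)
    (𝔭 : HeightOneSpectrum (𝓞 K)) (n : ℕ) (hn : 1 ≤ n) :
    ((n = 1 ∨ (2 : 𝓞 K) ∈ 𝔭.asIdeal) →
      ∀ m : ℕ, 1 ≤ m → (RepByUnimodular K 𝔭 n m ↔ n + 1 ≤ m)) ∧
    ((2 ≤ n ∧ (2 : 𝓞 K) ∉ 𝔭.asIdeal) →
      ∀ m : ℕ, 1 ≤ m → (RepByUnimodular K 𝔭 n m ↔ n + 2 ≤ m)) := by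
  have h2 := residue_algebraMap_eq_zero_iff 𝔭 2
  rw [map_ofNat, map_ofNat] at h2
  simp only [repByUnimodular_iff, ← h2]
  exact ⟨fun h m _ => ⟨fun hrep => hrep.add_one_le hn, allRepByUnimodular_of_add_one_le h⟩,
    fun h m _ => ⟨fun hrep => hrep.add_two_le h.2 h.1, allRepByUnimodular_of_add_two_le⟩⟩
end
end
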